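/- Let 1 < p ≤ q < ∞ satisfy 1/p − 1/q ≤ 1/d, and let Φ and Ψ be Young functions with Φ̄ ∈ B_{p,q} and Ψ̄ ∈ B_{q'}. Suppose u is a scalar weight and V is an n×n matrix weight on ℝ^d (n = d) such that sup_Q |Q|^{1/d + 1/q − 1/p} ‖u^{1/q}‖_{Ψ,Q} ‖V^{−1/p}‖_{Φ,Q} < ∞. Then for every vector-valued g, ‖ u^{1/q} I_1(|V^{−1/p} g|) ‖_{L^q(ℝ^d)} ≤ C ‖g‖_{L^p(ℝ^d,ℂ^n)}, where I_1 h(x) = ∫_{ℝ^d} h(y)/|x−y|^{d−1} dy. -/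

import Mathlib

open MeasureTheory ENNReal
open scoped NNReal ComplexOrder

noncomputable section

abbrev Rd (d : ℕ) := EuclideanSpace ℝ (Fin d)
abbrev Cn (n : ℕ) := EuclideanSpace ℂ (Fin n)
abbrev Mat (n : ℕ) := Matrix (Fin n) (Fin n) ℂ

/-- An axis-parallel (half-open) cube in `ℝ^d`. -/
structure Cube (d : ℕ) where
  corner : Fin d → ℝ
  side : ℝ
  side_pos : 0 < side

namespace Cube

/-- The set of points of a cube. -/
def set {d : ℕ} (Q : Cube d) : Set (Rd d) :=
  {x | ∀ i, Q.corner i ≤ x i ∧ x i < Q.corner i + Q.side}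

/-- The volume `|Q|` of a cube. -/
def vol {d : ℕ} (Q : Cube d) : ℝ := Q.side ^ d

end Cube

/-- A matrix acting on `ℂ^n` (with the Euclidean norm). -/
def mulVecE {n : ℕ} (A : Mat n) (v : Cn n) : Cn n :=
  Matrix.toEuclideanLin A v

/-- The operator norm `|A|_op` of a matrix acting on `ℓ²(ℂ^n)`. -/
def opNorm {n : ℕ} (A : Mat n) : ℝ :=
  ‖Matrix.toEuclideanCLM (𝕜 := ℂ) A‖

/-- Real powers of a self-adjoint matrix, defined via diagonalization. -/
def matPow {n : ℕ} (A : Mat n) (r : ℝ) : Mat n :=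
  if hA : A.IsHermitian then
    (hA.eigenvectorUnitary : Mat n) *
      Matrix.diagonal (fun i => ((hA.eigenvalues i ^ r : ℝ) : ℂ)) *
      (star hA.eigenvectorUnitary : Mat n)
  else A

/-- A matrix weight: self-adjoint matrix valued, locally integrable entries,
positive definite a.e. -/
def IsMatrixWeight {d n : ℕ} (U : Rd d → Mat n) : Prop :=
  (∀ i j, MeasureTheory.LocallyIntegrable (fun x => U x i j) volume) ∧
    (∀ᵐ x, (U x).PosDef)

/-- A Young function: convex, increasing, `Φ(0) = 0` and `Φ(t)/t → ∞`. -/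
structure IsYoungFunction (Φ : ℝ → ℝ) : Prop where
  convexOn : ConvexOn ℝ (Set.Ici 0) Φ
  monotoneOn : MonotoneOn Φ (Set.Ici 0)
  map_zero : Φ 0 = 0
  tendsto : Filter.Tendsto (fun t => Φ t / t) Filter.atTop Filter.atTop

/-- The associate Young function `Φ̄(t) = sup_{s>0} (st - Φ(s))`. -/
def assoc (Φ : ℝ → ℝ) : ℝ → ℝ :=
  fun t => sSup ((fun s => s * t - Φ s) '' Set.Ioi (0 : ℝ))

/-- The `B_{p,q}` condition: `∫_1^∞ Φ(t)^{q/p} t^{-q} dt/t < ∞`. -/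
def MemBpq (Φ : ℝ → ℝ) (p q : ℝ) : Prop :=
  ∫⁻ t in Set.Ioi (1 : ℝ), ENNReal.ofReal (Φ t ^ (q / p) / t ^ (q + 1)) < ⊤

/-- The `B_p` condition: `∫_1^∞ Φ(t) t^{-p} dt/t < ∞`. -/
def MemBp (Φ : ℝ → ℝ) (p : ℝ) : Prop :=
  ∫⁻ t in Set.Ioi (1 : ℝ), ENNReal.ofReal (Φ t / t ^ (p + 1)) < ⊤

/-- Localized Luxemburg (Orlicz) norm over a cube, for `ℝ≥0∞`-valued functions. -/
def luxNormE {d : ℕ} (Φ : ℝ → ℝ) (Q : Cube d) (f : Rd d → ℝ≥0∞) : ℝ≥0∞ :=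
  sInf {lam : ℝ≥0∞ | 0 < lam ∧ lam < ⊤ ∧
    (∫⁻ x in Q.set, ENNReal.ofReal (Φ ((f x).toReal / lam.toReal))) ≤ ENNReal.ofReal Q.vol}

/-- Localized Luxemburg (Orlicz) norm over a cube of a real valued function. -/
def luxNorm {d : ℕ} (Φ : ℝ → ℝ) (Q : Cube d) (f : Rd d → ℝ) : ℝ≥0∞ :=
  luxNormE Φ Q fun x => ENNReal.ofReal |f x|

/-- The (unweighted) `L^p` norm of a vector valued function. -/
def lpNorm {d n : ℕ} (p : ℝ) (f : Rd d → Cn n) : ℝ≥0∞ :=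
  (∫⁻ x, (‖f x‖₊ : ℝ≥0∞) ^ p) ^ (1 / p)

/-- The matrix-weighted `L^p(W)` norm `(∫ |W^{1/p} f|^p)^{1/p}`. -/
def wLpNorm {d n : ℕ} (p : ℝ) (W : Rd d → Mat n) (f : Rd d → Cn n) : ℝ≥0∞ :=
  (∫⁻ x, (‖mulVecE (matPow (W x) (1 / p)) (f x)‖₊ : ℝ≥0∞) ^ p) ^ (1 / p)


/-- A scalar weight: non-negative and locally integrable. -/
def IsScalarWeight {d : ℕ} (u : Rd d → ℝ) : Prop :=
  (∀ x, 0 ≤ u x) ∧ MeasureTheory.LocallyIntegrable u volume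

/-- The complexification of a real vector in `ℝ^d`. -/
def toCvec {d : ℕ} (v : Rd d) : Cn d :=
  (EuclideanSpace.equiv (Fin d) ℂ).symm fun i => (v i : ℂ)

namespace MixedBump

/-- The last index `k ≤ n` at which `b` more than doubles its previously recorded value. -/
def lastJump (b : ℕ → ℝ≥0∞) : ℕ → ℕ
  | 0 => 0
  | n + 1 => if 2 * b (lastJump b n) < b (n + 1) then n + 1 else lastJump b n

lemma lastJump_le (b : ℕ → ℝ≥0∞) (n : ℕ) : lastJump b n ≤ n := by
  induction n with
  | zero => simp [lastJump]
  | succ n ih =>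
    rw [lastJump]
    split_ifs
    · exact le_rfl
    · omega

lemma lastJump_congr {b c : ℕ → ℝ≥0∞} {n : ℕ} (h : ∀ k ≤ n, b k = c k) :
    lastJump b n = lastJump c n := by
  induction n with
  | zero => simp [lastJump]
  | succ n ih =>
    have ih' := ih fun k hk => h k (hk.trans n.le_succ)
    rw [lastJump, lastJump, ih', h _ le_rfl, h _ ((lastJump_le c n).trans n.le_succ)]

lemma lastJump_lastJump (b : ℕ → ℝ≥0∞) (n : ℕ) :
    lastJump b (lastJump b n) = lastJump b n := by
  induction n with
  | zero => simp [lastJump]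
  | succ n ih =>
    by_cases h : 2 * b (lastJump b n) < b (n + 1)
    · have : lastJump b (n + 1) = n + 1 := by rw [lastJump, if_pos h]
      rw [this, this]
    · have : lastJump b (n + 1) = lastJump b n := by rw [lastJump, if_neg h]
      rw [this, ih]

lemma lastJump_succ_eq_iff (b : ℕ → ℝ≥0∞) (n : ℕ) :
    lastJump b (n + 1) = n + 1 ↔ 2 * b (lastJump b n) < b (n + 1) := by
  rw [lastJump]
  split_ifs with h
  · simp [h]
  · have := lastJump_le b n
    simp only [h, iff_false]
    omega

lemma apply_le_two_mul_lastJump (b : ℕ → ℝ≥0∞) {k n : ℕ} (hk : k ≤ n) :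
    b k ≤ 2 * b (lastJump b n) := by
  have two_le (x : ℝ≥0∞) : x ≤ 2 * x := by rw [two_mul]; exact le_self_add
  induction n with
  | zero =>
    obtain rfl : k = 0 := by omega
    exact two_le _
  | succ n ih =>
    rw [lastJump]
    split_ifs with h
    · rcases hk.eq_or_lt with rfl | hk
      · exact two_le _
      · exact (ih (by omega)).trans (h.le.trans (two_le _))
    · rcases hk.eq_or_lt with rfl | hk
      · exact not_lt.1 h
      · exact ih (by omega)

/-- A geometrically weighted sum is controlled by its jump terms. -/
lemma sum_le_sum_jumps (b l : ℕ → ℝ≥0∞) (hl : ∀ n, 2 * l (n + 1) = l n) (n : ℕ) :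
    ∑ k ∈ Finset.range (n + 1), l k * b k ≤
      4 * ∑ k ∈ Finset.range (n + 1), if lastJump b k = k then l k * b k else 0 := by
  suffices h : ∑ k ∈ Finset.range (n + 1), l k * b k + 2 * (l n * b (lastJump b n)) ≤
      4 * ∑ k ∈ Finset.range (n + 1), if lastJump b k = k then l k * b k else 0 from
    le_self_add.trans h
  induction n with
  | zero =>
    simp only [zero_add, Finset.range_one, Finset.sum_singleton, lastJump, if_true]
    calc _ = 3 * (l 0 * b 0) := by ring
      _ ≤ _ := by gcongr; norm_num
  | succ n ih =>
    rw [Finset.sum_range_succ, Finset.sum_range_succ _ (n + 1), mul_add]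
    by_cases h : 2 * b (lastJump b n) < b (n + 1)
    · have hj : lastJump b (n + 1) = n + 1 := by rw [lastJump, if_pos h]
      rw [if_pos hj, hj]
      calc _ = ∑ k ∈ Finset.range (n + 1), l k * b k + 3 * (l (n + 1) * b (n + 1)) := by ring
        _ ≤ _ := by
          gcongr ?_ + ?_
          · exact le_self_add.trans ih
          · gcongr; norm_num
    · have hj : lastJump b (n + 1) = lastJump b n := by rw [lastJump, if_neg h]
      have hj' : lastJump b (n + 1) ≠ n + 1 := by
        rw [hj]; have := lastJump_le b n; omega
      rw [if_neg hj', hj, mul_zero, add_zero]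
      refine le_trans ?_ ih
      rw [add_assoc]
      gcongr
      rw [← hl n]
      calc _ ≤ l (n + 1) * (2 * b (lastJump b n)) + 2 * (l (n + 1) * b (lastJump b n)) := by
            gcongr; exact not_lt.1 h
        _ = _ := by ring

lemma sup_rpow_le_sum_jumps (b : ℕ → ℝ≥0∞) {q : ℝ} (hq : 0 ≤ q) (n : ℕ) :
    ((Finset.range (n + 1)).sup b) ^ q ≤
      2 ^ q * ∑ k ∈ Finset.range (n + 1), if lastJump b k = k then b k ^ q else 0 := by
  have h1 : (Finset.range (n + 1)).sup b ≤ 2 * b (lastJump b n) :=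
    Finset.sup_le fun k hk => apply_le_two_mul_lastJump b (by simpa [Nat.lt_succ_iff] using hk)
  calc _ ≤ (2 * b (lastJump b n)) ^ q := ENNReal.rpow_le_rpow h1 hq
    _ = 2 ^ q * b (lastJump b n) ^ q := ENNReal.mul_rpow_of_nonneg _ _ hq
    _ ≤ _ := by
      gcongr
      refine le_trans ?_ (Finset.single_le_sum (fun _ _ => zero_le)
        (Finset.mem_range.2 (Nat.lt_succ_of_le (lastJump_le b n))))
      rw [if_pos (lastJump_lastJump b n)]

/-- A nested sequence of partitions, those of the `n`-th one having measure `vol n`. -/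
structure UniformGrid {X : Type*} [MeasurableSpace X] (μ : Measure X) (ι : Type*)
    [MeasurableSpace ι] where
  idx : ℕ → X → ι
  measurable_idx : ∀ n, Measurable (idx n)
  nested : ∀ n x y, idx (n + 1) x = idx (n + 1) y → idx n x = idx n y
  vol : ℕ → ℝ≥0∞
  vol_ne_zero : ∀ n, vol n ≠ 0
  vol_ne_top : ∀ n, vol n ≠ ⊤
  measure_cell : ∀ n x, μ {y | idx n y = idx n x} = vol n

namespace UniformGrid

variable {X ι : Type*} [MeasurableSpace X] {μ : Measure X} [MeasurableSpace ι]
  (𝒢 : UniformGrid μ ι)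

/-- The member of the `n`-th partition that contains `x`. -/
def cell (n : ℕ) (x : X) : Set X := {y | 𝒢.idx n y = 𝒢.idx n x}

/-- The average of `g` over the cell of `x`. -/
def avg (n : ℕ) (g : X → ℝ≥0∞) (x : X) : ℝ≥0∞ := (∫⁻ y in 𝒢.cell n x, g y ∂μ) / 𝒢.vol n

/-- Functions that are constant on the cells of the `n`-th partition. -/
def CellConst {β : Type*} (n : ℕ) (k : X → β) : Prop :=
  ∀ x y, 𝒢.idx n x = 𝒢.idx n y → k x = k y

lemma idx_eq_of_le {m n : ℕ} (h : m ≤ n) {x y : X} (hxy : 𝒢.idx n x = 𝒢.idx n y) :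
    𝒢.idx m x = 𝒢.idx m y := by
  induction n, h using Nat.le_induction with
  | base => exact hxy
  | succ n _ ih => exact ih (𝒢.nested n x y hxy)

variable {𝒢} in
lemma CellConst.mono {β : Type*} {m n : ℕ} (h : m ≤ n) {k : X → β} (hk : 𝒢.CellConst m k) :
    𝒢.CellConst n k := fun x y hxy => hk x y (𝒢.idx_eq_of_le h hxy)

lemma cell_eq {n : ℕ} {x y : X} (h : 𝒢.idx n x = 𝒢.idx n y) : 𝒢.cell n x = 𝒢.cell n y := by
  simp [cell, h]

lemma cellConst_avg (n : ℕ) (g : X → ℝ≥0∞) : 𝒢.CellConst n (𝒢.avg n g) := fun x y h => by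
  simp [avg, 𝒢.cell_eq h]

lemma vol_antitone [Nonempty X] : Antitone 𝒢.vol := by
  obtain ⟨x⟩ := ‹Nonempty X›
  intro m n h
  rw [← 𝒢.measure_cell n x, ← 𝒢.measure_cell m x]
  exact measure_mono fun y hy => 𝒢.idx_eq_of_le h hy

lemma cellConst_lastJump {b : ℕ → X → ℝ≥0∞} (hb : ∀ n, 𝒢.CellConst n (b n)) (n : ℕ) :
    𝒢.CellConst n fun x => lastJump (fun j => b j x) n := fun _ _ h =>
  lastJump_congr fun k hk => (hb k).mono hk _ _ h

variable [DiscreteMeasurableSpace ι]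

variable {𝒢} in
lemma CellConst.measurable {β : Type*} [MeasurableSpace β] {n : ℕ} {k : X → β}
    (hk : 𝒢.CellConst n k) : Measurable k := by
  intro s _
  have : k ⁻¹' s = 𝒢.idx n ⁻¹' (𝒢.idx n '' (k ⁻¹' s)) := by
    refine Set.Subset.antisymm (Set.subset_preimage_image _ _) ?_
    rintro x ⟨y, hy, hxy⟩
    simpa [Set.mem_preimage, hk x y hxy.symm] using hy
  rw [this]
  exact 𝒢.measurable_idx n (MeasurableSet.of_discrete)

lemma measurableSet_cell (n : ℕ) (x : X) : MeasurableSet (𝒢.cell n x) :=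
  𝒢.measurable_idx n (MeasurableSet.of_discrete (s := {𝒢.idx n x}))

lemma lintegral_mul_avg [SFinite μ] [Countable ι] {n : ℕ} {k g : X → ℝ≥0∞}
    (hk : 𝒢.CellConst n k) (hg : Measurable g) :
    ∫⁻ x, k x * 𝒢.avg n g x ∂μ = ∫⁻ x, k x * g x ∂μ := by
  have hS : MeasurableSet {z : X × X | 𝒢.idx n z.2 = 𝒢.idx n z.1} :=
    measurableSet_eq_fun ((𝒢.measurable_idx n).comp measurable_snd)
      ((𝒢.measurable_idx n).comp measurable_fst)
  let H : X × X → ℝ≥0∞ := {z : X × X | 𝒢.idx n z.2 = 𝒢.idx n z.1}.indicator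
    fun z => k z.1 * g z.2 / 𝒢.vol n
  have hH : Measurable H := Measurable.indicator
    (((hk.measurable.comp measurable_fst).mul (hg.comp measurable_snd)).div_const _) hS
  have h1 (x : X) : k x * 𝒢.avg n g x = ∫⁻ y, H (x, y) ∂μ := by
    have : (fun y => H (x, y)) = (𝒢.cell n x).indicator fun y => k x * g y / 𝒢.vol n := by
      ext y
      by_cases h : 𝒢.idx n y = 𝒢.idx n x <;> simp [H, cell, Set.indicator, h]
    rw [this, lintegral_indicator (𝒢.measurableSet_cell n x), avg]
    simp only [div_eq_mul_inv, mul_assoc]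
    rw [lintegral_const_mul _ (hg.mul_const _), lintegral_mul_const _ hg]
  have h2 (y : X) : ∫⁻ x, H (x, y) ∂μ = k y * g y := by
    have : (fun x => H (x, y)) = (𝒢.cell n y).indicator fun _ => k y * g y / 𝒢.vol n := by
      ext x
      by_cases h : 𝒢.idx n x = 𝒢.idx n y
      · simp [H, cell, Set.indicator, h, hk x y h]
      · simp [H, cell, Set.indicator, h, Ne.symm h]
    rw [this, lintegral_indicator (𝒢.measurableSet_cell n y), setLIntegral_const]
    rw [show μ (𝒢.cell n y) = 𝒢.vol n from 𝒢.measure_cell n y,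
      ENNReal.div_mul_cancel (𝒢.vol_ne_zero n) (𝒢.vol_ne_top n)]
  simp_rw [h1]
  rw [lintegral_lintegral_swap (f := fun x y => H (x, y)) hH.aemeasurable]
  simp_rw [h2]

end UniformGrid

namespace UniformGrid

variable {X ι : Type*} [MeasurableSpace X] {μ : Measure X} [MeasurableSpace ι]
  (𝒢 : UniformGrid μ ι) [DiscreteMeasurableSpace ι]

section Sparse

variable [SFinite μ] [Countable ι]

lemma lintegral_stopped_le {G : X → ℝ≥0∞} (hG : Measurable G) {n m : ℕ} (hnm : n ≤ m)
    {a : X → ℝ≥0∞} (ha : 𝒢.CellConst n a)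
    (haJ : ∀ x, a x ≠ 0 → lastJump (fun j => 𝒢.avg j G x) n = n) :
    ∫⁻ x, a x * (if lastJump (fun j => 𝒢.avg j G x) m = n then G x else 2 * 𝒢.avg n G x) ∂μ ≤
      ∫⁻ x, a x * G x ∂μ := by
  induction m, hnm using Nat.le_induction with
  | base =>
    refine lintegral_mono fun x => ?_
    by_cases h : a x = 0
    · simp [h]
    · rw [if_pos (haJ x h)]
  | succ m hnm ih =>
    refine le_trans ?_ ih
    set b : X → ℕ → ℝ≥0∞ := fun x j => 𝒢.avg j G x
    have hbc : ∀ j, 𝒢.CellConst j fun x => b x j := fun j => 𝒢.cellConst_avg j G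
    let Z : Set X := {x | lastJump (b x) m = n ∧ 2 * b x n < b x (m + 1)}
    have hZc : 𝒢.CellConst (m + 1) (Z.indicator a) := by
      intro x y h
      have h1 := (𝒢.cellConst_lastJump (b := fun j x => b x j) hbc m).mono m.le_succ x y h
      have h2 := (hbc n).mono (hnm.trans m.le_succ) x y h
      have h3 := hbc (m + 1) x y h
      have h4 := ha.mono (hnm.trans m.le_succ) x y h
      dsimp only at h1 h2 h3
      have hxy : x ∈ Z ↔ y ∈ Z := by simp only [Z, Set.mem_ofPred_eq, h1, h2, h3]
      by_cases hx : x ∈ Z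
      · rw [Set.indicator_of_mem hx, Set.indicator_of_mem (hxy.1 hx), h4]
      · rw [Set.indicator_of_notMem hx, Set.indicator_of_notMem fun h => hx (hxy.2 h)]
    have hZ : MeasurableSet Z := by
      have hc : 𝒢.CellConst (m + 1) fun x => x ∈ Z := by
        intro x y h
        have h1 := (𝒢.cellConst_lastJump (b := fun j x => b x j) hbc m).mono m.le_succ x y h
        have h2 := (hbc n).mono (hnm.trans m.le_succ) x y h
        have h3 := hbc (m + 1) x y h
        dsimp only at h1 h2 h3
        simp only [Z, Set.mem_ofPred_eq, h1, h2, h3]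
      exact measurableSet_setOfPred.2 hc.measurable
    rw [← lintegral_add_compl (fun x => a x * if lastJump (b x) (m + 1) = n then _ else _) hZ,
      ← lintegral_add_compl (fun x => a x * if lastJump (b x) m = n then _ else _) hZ]
    gcongr ?_ + ?_
    · calc _ ≤ ∫⁻ x in Z, a x * b x (m + 1) ∂μ := by
            refine setLIntegral_mono' hZ fun x hx => ?_
            have hj : lastJump (b x) (m + 1) = m + 1 := by
              rw [lastJump_succ_eq_iff, hx.1]; exact hx.2
            rw [hj, if_neg (by omega)]
            gcongr
            exact hx.2.le
        _ = ∫⁻ x in Z, a x * G x ∂μ := by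
            have := 𝒢.lintegral_mul_avg hZc hG
            simp only [← Set.indicator_mul_left] at this
            rwa [lintegral_indicator hZ, lintegral_indicator hZ] at this
        _ = _ := by
            refine setLIntegral_congr_fun hZ fun x hx => ?_
            simp only [hx.1, if_true]
    · refine setLIntegral_mono' hZ.compl fun x hx => ?_
      gcongr
      have key : lastJump (b x) (m + 1) = n ↔ lastJump (b x) m = n := by
        constructor
        · intro h
          rw [lastJump] at h
          split_ifs at h with h'
          · omega
          · exact h
        · intro h
          rw [lastJump, if_neg, h]
          rw [h]
          exact fun h' => hx ⟨h, h'⟩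
      simp only [key]
      exact le_rfl

lemma one_le_two_mul_avg_last {G : X → ℝ≥0∞} (hG : Measurable G) (hGi : ∫⁻ x, G x ∂μ ≠ ⊤)
    {n m : ℕ} (hnm : n ≤ m) {x : X} (hx : lastJump (fun j => 𝒢.avg j G x) n = n)
    (h0 : 𝒢.avg n G x ≠ 0) :
    1 ≤ 2 * 𝒢.avg n (fun y => if lastJump (fun j => 𝒢.avg j G y) m = n then 1 else 0) x := by
  have hC := 𝒢.measurableSet_cell n x
  have hv0 := 𝒢.vol_ne_zero n
  have hvt := 𝒢.vol_ne_top n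
  have hT : Measurable fun y => lastJump (fun j => 𝒢.avg j G y) m :=
    (𝒢.cellConst_lastJump (fun j => 𝒢.cellConst_avg j G) m).measurable
  have hTs : MeasurableSet {y | lastJump (fun j => 𝒢.avg j G y) m = n} :=
    hT (MeasurableSet.of_discrete (s := {n}))
  have ht : 𝒢.avg n G x ≠ ⊤ :=
    (ENNReal.div_lt_top (ne_top_of_le_ne_top hGi (setLIntegral_le_lintegral _ _)) hv0).ne
  have h := 𝒢.lintegral_stopped_le hG hnm (a := (𝒢.cell n x).indicator 1)
    (fun y z h => by
      by_cases h' : 𝒢.idx n z = 𝒢.idx n x <;> simp [Set.indicator, cell, h, h'])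
    (fun y hy => by
      have hy' : y ∈ 𝒢.cell n x := by
        by_contra h'; exact hy (by simp [h'])
      exact (𝒢.cellConst_lastJump (fun j => 𝒢.cellConst_avg j G) n y x hy').trans hx)
  have hind (g : X → ℝ≥0∞) : ∫⁻ y, (𝒢.cell n x).indicator 1 y * g y ∂μ =
      ∫⁻ y in 𝒢.cell n x, g y ∂μ := by
    rw [← lintegral_indicator hC]
    congr 1
    ext y
    by_cases h' : y ∈ 𝒢.cell n x <;> simp [h']
  rw [hind, hind] at h
  have hN : (∫⁻ y in 𝒢.cell n x, if lastJump (fun j => 𝒢.avg j G y) m = n then 0 else 1 ∂μ) * 2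
      ≤ 𝒢.vol n := by
    have h1 : ∫⁻ y in 𝒢.cell n x, G y ∂μ = 𝒢.vol n * 𝒢.avg n G x :=
      (ENNReal.mul_div_cancel hv0 hvt).symm
    rw [h1] at h
    have h2 : (∫⁻ y in 𝒢.cell n x, if lastJump (fun j => 𝒢.avg j G y) m = n then 0 else 1 ∂μ)
        * 2 * 𝒢.avg n G x ≤ 𝒢.vol n * 𝒢.avg n G x := by
      refine le_trans ?_ h
      rw [mul_assoc, ← lintegral_mul_const _ (Measurable.ite hTs measurable_const measurable_const)]
      refine setLIntegral_mono' hC fun y hy => ?_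
      split_ifs
      · simp
      · rw [one_mul, 𝒢.cellConst_avg n G y x hy]
    exact (ENNReal.mul_le_mul_iff_left h0 ht).1 h2
  have hs : (∫⁻ y in 𝒢.cell n x, if lastJump (fun j => 𝒢.avg j G y) m = n then 0 else 1 ∂μ) +
      (∫⁻ y in 𝒢.cell n x, if lastJump (fun j => 𝒢.avg j G y) m = n then 1 else 0 ∂μ)
      = 𝒢.vol n := by
    rw [← lintegral_add_left (Measurable.ite hTs measurable_const measurable_const),
      ← 𝒢.measure_cell n x]
    change _ = μ (𝒢.cell n x)
    rw [← setLIntegral_one]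
    congr 1
    ext y
    split_ifs <;> simp
  rw [avg, ← mul_div_assoc, ENNReal.le_div_iff_mul_le (Or.inl hv0) (Or.inl hvt), one_mul]
  set N := ∫⁻ y in 𝒢.cell n x, if lastJump (fun j => 𝒢.avg j G y) m = n then 0 else 1 ∂μ
  set P := ∫⁻ y in 𝒢.cell n x, if lastJump (fun j => 𝒢.avg j G y) m = n then 1 else 0 ∂μ
  have : 𝒢.vol n + 𝒢.vol n ≤ 𝒢.vol n + 2 * P := by
    calc _ = N * 2 + 2 * P := by rw [← two_mul]; nth_rw 1 [← hs]; ring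
      _ ≤ _ := by gcongr
  exact (ENNReal.add_le_add_iff_left hvt).1 this

/-- Sparse domination in integrated form. -/
theorem sum_lintegral_mul_avg_le {F G : X → ℝ≥0∞} (hF : Measurable F) (hG : Measurable G)
    (hGi : ∫⁻ x, G x ∂μ ≠ ⊤) (l : ℕ → ℝ≥0∞) (hl : ∀ n, 2 * l (n + 1) = l n) (L : ℕ) :
    ∑ n ∈ Finset.range (L + 1), ∫⁻ x, l n * (G x * 𝒢.avg n F x) ∂μ ≤
      8 * ∫⁻ x, (Finset.range (L + 1)).sup
        (fun n => l n * 𝒢.avg n F x * 𝒢.avg n G x) ∂μ := by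
  let k : ℕ → X → ℝ≥0∞ := fun n x =>
    if lastJump (fun j => 𝒢.avg j G x) n = n then l n * 𝒢.avg n G x else 0
  have hT (m : ℕ) : Measurable fun y => lastJump (fun j => 𝒢.avg j G y) m :=
    (𝒢.cellConst_lastJump (fun j => 𝒢.cellConst_avg j G) m).measurable
  have hTs (m n : ℕ) : MeasurableSet {y | lastJump (fun j => 𝒢.avg j G y) m = n} :=
    hT m (MeasurableSet.of_discrete (s := {n}))
  have hk (n : ℕ) : 𝒢.CellConst n (k n) := fun x y h => by
    have h1 := 𝒢.cellConst_lastJump (fun j => 𝒢.cellConst_avg j G) n x y h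
    dsimp only at h1
    simp only [k, h1, 𝒢.cellConst_avg n G x y h]
  have havF (n : ℕ) : Measurable (𝒢.avg n F) := (𝒢.cellConst_avg n F).measurable
  have havG (n : ℕ) : Measurable (𝒢.avg n G) := (𝒢.cellConst_avg n G).measurable
  have hsym (n : ℕ) : ∫⁻ x, l n * (G x * 𝒢.avg n F x) ∂μ =
      ∫⁻ x, F x * (l n * 𝒢.avg n G x) ∂μ := by
    calc _ = l n * ∫⁻ x, 𝒢.avg n F x * G x ∂μ := by
          rw [← lintegral_const_mul _ (by fun_prop)]
          simp only [mul_comm]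
      _ = l n * ∫⁻ x, 𝒢.avg n G x * F x ∂μ := by
          rw [← 𝒢.lintegral_mul_avg (𝒢.cellConst_avg n F) hG,
            ← 𝒢.lintegral_mul_avg (𝒢.cellConst_avg n G) hF]
          simp only [mul_comm]
      _ = _ := by
          rw [← lintegral_const_mul _ (by fun_prop)]
          congr 1; ext x; ring
  have hkF (n : ℕ) (hn : n ≤ L) : ∫⁻ x, F x * k n x ∂μ ≤
      2 * ∫⁻ x, (if lastJump (fun j => 𝒢.avg j G x) L = n then
        l n * 𝒢.avg n F x * 𝒢.avg n G x else 0) ∂μ := by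
    let e : X → ℝ≥0∞ := fun y => if lastJump (fun j => 𝒢.avg j G y) L = n then 1 else 0
    have he : Measurable e := Measurable.ite (hTs L n) measurable_const measurable_const
    have hkc : 𝒢.CellConst n fun x => k n x * 𝒢.avg n F x := fun x y h => by
      simp only [hk n x y h, 𝒢.cellConst_avg n F x y h]
    calc _ = ∫⁻ x, k n x * 𝒢.avg n F x ∂μ := by
          rw [𝒢.lintegral_mul_avg (hk n) hF]; simp only [mul_comm]
      _ ≤ ∫⁻ x, 2 * ((k n x * 𝒢.avg n F x) * 𝒢.avg n e x) ∂μ := by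
          refine lintegral_mono fun x => ?_
          by_cases hkx : k n x = 0
          · simp [hkx]
          · have hJ : lastJump (fun j => 𝒢.avg j G x) n = n := by
              by_contra h'; exact hkx (if_neg h')
            have h0 : 𝒢.avg n G x ≠ 0 := fun h' => hkx (by simp [k, h'])
            calc _ = k n x * 𝒢.avg n F x * 1 := (mul_one _).symm
              _ ≤ k n x * 𝒢.avg n F x * (2 * 𝒢.avg n e x) := by
                gcongr; exact 𝒢.one_le_two_mul_avg_last hG hGi hn hJ h0
              _ = _ := by ring
      _ = 2 * ∫⁻ x, (k n x * 𝒢.avg n F x) * e x ∂μ := by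
          rw [lintegral_const_mul _ (hkc.measurable.fun_mul (𝒢.cellConst_avg n e).measurable),
            𝒢.lintegral_mul_avg hkc he]
      _ ≤ _ := by
          gcongr with x
          simp only [e]
          split_ifs
          · simp only [k]
            split_ifs
            · rw [mul_one]; exact le_of_eq (by ring)
            · simp
          · simp
  have hkm (n : ℕ) : Measurable (k n) := (hk n).measurable
  calc _ = ∑ n ∈ Finset.range (L + 1), ∫⁻ x, F x * (l n * 𝒢.avg n G x) ∂μ := by simp_rw [hsym]
    _ = ∫⁻ x, F x * ∑ n ∈ Finset.range (L + 1), l n * 𝒢.avg n G x ∂μ := by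
        rw [← lintegral_finsetSum _ fun n _ => by fun_prop]
        simp_rw [Finset.mul_sum]
    _ ≤ ∫⁻ x, F x * (4 * ∑ n ∈ Finset.range (L + 1), k n x) ∂μ := by
        gcongr with x
        exact sum_le_sum_jumps _ l hl L
    _ = 4 * ∑ n ∈ Finset.range (L + 1), ∫⁻ x, F x * k n x ∂μ := by
        rw [← lintegral_finsetSum _ fun n _ => hF.fun_mul (hkm n), ← lintegral_const_mul _
          (Finset.measurable_fun_sum _ fun n _ => hF.fun_mul (hkm n))]
        congr 1; ext x; rw [← Finset.mul_sum]; ring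
    _ ≤ 4 * ∑ n ∈ Finset.range (L + 1), 2 * ∫⁻ x, (if lastJump (fun j => 𝒢.avg j G x) L = n then
        l n * 𝒢.avg n F x * 𝒢.avg n G x else 0) ∂μ := by
        gcongr with n hn
        exact hkF n (Nat.lt_succ_iff.1 (Finset.mem_range.1 hn))
    _ = 8 * ∫⁻ x, ∑ n ∈ Finset.range (L + 1), (if lastJump (fun j => 𝒢.avg j G x) L = n then
        l n * 𝒢.avg n F x * 𝒢.avg n G x else 0) ∂μ := by
        rw [lintegral_finsetSum _ fun n _ => Measurable.ite (hTs L n)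
          (((havF n).const_mul _).fun_mul (havG n)) measurable_const, ← Finset.mul_sum, ← mul_assoc]
        norm_num
    _ ≤ _ := by
        gcongr with x
        rw [Finset.sum_ite_eq]
        split_ifs with h
        · exact Finset.le_sup (f := fun n => l n * 𝒢.avg n F x * 𝒢.avg n G x) h
        · exact zero_le

end Sparse
end UniformGrid

/-- The density of the `B_{p,q}` integral, with `r = q / p`. -/
def bumpDensity (A : ℝ≥0∞ → ℝ≥0∞) (q r : ℝ) (s : ℝ) : ℝ≥0∞ :=
  A (ENNReal.ofReal s) ^ r * ENNReal.ofReal s ^ (-(q + 1))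

/-- The part of the `B_{p,q}` integral over `s > t`. -/
def bumpTail (A : ℝ≥0∞ → ℝ≥0∞) (q r : ℝ) (t : ℝ≥0∞) : ℝ≥0∞ :=
  ∫⁻ s in {s : ℝ | t < ENNReal.ofReal s}, bumpDensity A q r s

section Tail

variable {A : ℝ≥0∞ → ℝ≥0∞} {q r : ℝ}

lemma bumpTail_anti {s t : ℝ≥0∞} (h : s ≤ t) : bumpTail A q r t ≤ bumpTail A q r s :=
  lintegral_mono_set fun _ hx => h.trans_lt hx

lemma le_bumpTail (hA : Monotone A) (hq : 0 ≤ q) (hr : 0 ≤ r) {t : ℝ≥0∞} (h0 : t ≠ 0)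
    (ht : t ≠ ⊤) :
    A t ^ r ≤ 2 ^ (q + 1) * t ^ q *
      ∫⁻ s in {s : ℝ | t < ENNReal.ofReal s ∧ ENNReal.ofReal s ≤ 2 * t}, bumpDensity A q r s := by
  have hτ : 0 < t.toReal := ENNReal.toReal_pos h0 ht
  have hvol : volume (Set.Ioc t.toReal (2 * t.toReal)) = t := by
    rw [Real.volume_Ioc, show 2 * t.toReal - t.toReal = t.toReal by ring, ENNReal.ofReal_toReal ht]
  have hsub : Set.Ioc t.toReal (2 * t.toReal) ⊆
      {s : ℝ | t < ENNReal.ofReal s ∧ ENNReal.ofReal s ≤ 2 * t} := by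
    intro s hs
    refine ⟨(ENNReal.lt_ofReal_iff_toReal_lt ht).2 hs.1, ?_⟩
    refine ENNReal.ofReal_le_of_le_toReal ?_
    simpa using hs.2
  have h2t : (2 * t) ^ (-(q + 1)) * (2 * t) ^ (q + 1) = 1 := by
    rw [← ENNReal.rpow_add _ _ (by simp [h0]) (ENNReal.mul_ne_top (by simp) ht)]
    simp
  calc A t ^ r = A t ^ r * ((2 * t) ^ (-(q + 1)) * (2 * t) ^ (q + 1)) := by rw [h2t, mul_one]
    _ = 2 ^ (q + 1) * t ^ q * (A t ^ r * (2 * t) ^ (-(q + 1)) * t) := by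
        rw [ENNReal.mul_rpow_of_nonneg _ _ (by positivity : 0 ≤ q + 1),
          ENNReal.rpow_add _ _ h0 ht, ENNReal.rpow_one]
        ring
    _ = 2 ^ (q + 1) * t ^ q *
        ∫⁻ s in Set.Ioc t.toReal (2 * t.toReal), A t ^ r * (2 * t) ^ (-(q + 1)) := by
        rw [setLIntegral_const, hvol]
    _ ≤ 2 ^ (q + 1) * t ^ q * ∫⁻ s in Set.Ioc t.toReal (2 * t.toReal), bumpDensity A q r s := by
        gcongr 2 ^ (q + 1) * t ^ q * ?_
        refine setLIntegral_mono' measurableSet_Ioc fun s hs => ?_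
        have hs' := hsub hs
        rw [bumpDensity]
        refine mul_le_mul' (ENNReal.rpow_le_rpow (hA hs'.1.le) hr) ?_
        rw [ENNReal.rpow_neg, ENNReal.rpow_neg]
        exact ENNReal.inv_le_inv.2 (ENNReal.rpow_le_rpow hs'.2 (by positivity))
    _ ≤ _ := by gcongr

lemma rpow_add_bumpTail_le (hA : Monotone A) (hq : 0 ≤ q) (hr : 0 ≤ r) {t : ℝ≥0∞} (h0 : t ≠ 0)
    (ht : t ≠ ⊤) {c : ℝ≥0∞} (hc : 2 ^ (q + 1) * t ^ q ≤ c) :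
    A t ^ r + c * bumpTail A q r (2 * t) ≤ c * bumpTail A q r t := by
  have hm : MeasurableSet {s : ℝ | 2 * t < ENNReal.ofReal s} :=
    measurableSet_lt measurable_const ENNReal.measurable_ofReal
  have h1 : bumpTail A q r t =
      (∫⁻ s in {s : ℝ | t < ENNReal.ofReal s ∧ ENNReal.ofReal s ≤ 2 * t}, bumpDensity A q r s) +
      bumpTail A q r (2 * t) := by
    rw [bumpTail, bumpTail, ← lintegral_union hm]
    · congr 2
      ext s
      simp only [Set.mem_ofPred_eq, Set.mem_union]
      constructor
      · intro h
        rcases le_or_gt (ENNReal.ofReal s) (2 * t) with h' | h'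
        · exact Or.inl ⟨h, h'⟩
        · exact Or.inr h'
      · rintro (h | h)
        · exact h.1
        · refine lt_of_le_of_lt ?_ h
          rw [two_mul]; exact le_self_add
    · rw [Set.disjoint_left]
      exact fun s hs hs' => absurd hs.2 (not_le.2 hs')
  rw [h1, mul_add]
  gcongr
  exact (le_bumpTail hA hq hr h0 ht).trans (by gcongr)

lemma sum_jumps_le_bumpTail (hA : Monotone A) (hA1 : ∀ t ≤ 1, A t = 0) (hq : 0 < q) (hr : 0 < r)
    {f : ℝ≥0∞} (hf : f ≠ ⊤) {lam c : ℕ → ℝ≥0∞} (hlam : ∀ n, lam n ≠ ⊤) (hc : Antitone c)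
    (hc0 : ∀ n, c n ≠ 0) (hct : ∀ n, c n ≠ ⊤) (n : ℕ) :
    ∑ k ∈ Finset.range (n + 1), (if lastJump (fun j => c j * lam j) k = k then
      lam k ^ q * A (2 * f / lam k) ^ r else 0) ≤
    2 ^ (q + 1) * (2 * f) ^ q *
      bumpTail A q r (2 * f / lam (lastJump (fun j => c j * lam j) n)) := by
  have step (a a' : ℝ≥0∞) (ha : a ≠ ⊤) (haa : 2 * a' ≤ a) :
      a ^ q * A (2 * f / a) ^ r + 2 ^ (q + 1) * (2 * f) ^ q * bumpTail A q r (2 * f / a') ≤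
        2 ^ (q + 1) * (2 * f) ^ q * bumpTail A q r (2 * f / a) := by
    rcases eq_or_ne a 0 with rfl | ha0
    · have : a' = 0 := by simpa using haa
      subst this
      simp [hq]
    rcases eq_or_ne f 0 with rfl | hf0
    · simp [hq, hA1 0 zero_le_one, hr]
    set t := 2 * f / a with ht
    have ht0 : t ≠ 0 := by simp [ht, hf0, ha]
    have htt : t ≠ ⊤ := (ENNReal.div_lt_top (ENNReal.mul_ne_top (by simp) hf) ha0).ne
    have hat : a ^ q * t ^ q = (2 * f) ^ q := by
      rw [← ENNReal.mul_rpow_of_nonneg _ _ hq.le, ht, ENNReal.mul_div_cancel ha0 ha]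
    have h2t : 2 * t ≤ 2 * f / a' := by
      rw [ENNReal.le_div_iff_mul_le (Or.inr (by simp [hf0]))
        (Or.inr (ENNReal.mul_ne_top (by simp) hf))]
      calc 2 * t * a' = t * (2 * a') := by ring
        _ ≤ t * a := by gcongr
        _ = 2 * f := by rw [ht, ENNReal.div_mul_cancel ha0 ha]
    calc _ ≤ a ^ q * A t ^ r + 2 ^ (q + 1) * (2 * f) ^ q * bumpTail A q r (2 * t) := by
          gcongr; exact bumpTail_anti h2t
      _ = a ^ q * (A t ^ r + 2 ^ (q + 1) * t ^ q * bumpTail A q r (2 * t)) := by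
          rw [← hat]; ring
      _ ≤ a ^ q * (2 ^ (q + 1) * t ^ q * bumpTail A q r t) := by
          gcongr; exact rpow_add_bumpTail_le hA hq.le hr.le ht0 htt le_rfl
      _ = _ := by rw [← hat]; ring
  induction n with
  | zero =>
    simp only [zero_add, Finset.range_one, Finset.sum_singleton, lastJump, if_true]
    exact le_self_add.trans (step (lam 0) 0 (hlam 0) (by simp))
  | succ n ih =>
    rw [Finset.sum_range_succ]
    split_ifs with hj
    · rw [hj]
      refine le_trans ?_ (step (lam (n + 1)) (lam (lastJump (fun j => c j * lam j) n))
        (hlam _) ?_)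
      · rw [add_comm]; gcongr
      · have h := ((lastJump_succ_eq_iff _ _).1 hj).le
        have h' : 2 * (c (n + 1) * lam (lastJump (fun j => c j * lam j) n)) ≤
            c (n + 1) * lam (n + 1) := by
          refine le_trans ?_ h
          gcongr
          exact hc ((lastJump_le _ _).trans n.le_succ)
        rw [← mul_assoc, mul_comm 2, mul_assoc] at h'
        exact (ENNReal.mul_le_mul_iff_right (hc0 _) (hct _)).1 h'
    · have : lastJump (fun j => c j * lam j) (n + 1) = lastJump (fun j => c j * lam j) n := by
        rw [lastJump, if_neg]
        exact fun h => hj ((lastJump_succ_eq_iff _ _).2 h)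
      rw [this, add_zero]
      exact ih

end Tail

namespace UniformGrid

variable {X ι : Type*} [MeasurableSpace X] {μ : Measure X} [MeasurableSpace ι]
  (𝒢 : UniformGrid μ ι)

/-- The Luxemburg norm of `f` over the cell of `x`. -/
def lux (A : ℝ≥0∞ → ℝ≥0∞) (n : ℕ) (f : X → ℝ≥0∞) (x : X) : ℝ≥0∞ :=
  sInf {lam | ∫⁻ y in 𝒢.cell n x, A (f y / lam) ∂μ ≤ 𝒢.vol n}

lemma cellConst_lux (A : ℝ≥0∞ → ℝ≥0∞) (n : ℕ) (f : X → ℝ≥0∞) :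
    𝒢.CellConst n (𝒢.lux A n f) := fun x y h => by simp [lux, 𝒢.cell_eq h]

variable {A : ℝ≥0∞ → ℝ≥0∞} {f : X → ℝ≥0∞}

lemma lux_le (hA1 : ∀ t ≤ 1, A t = 0) {M : ℝ≥0∞} (hf : ∀ x, f x ≤ M) (n : ℕ) (x : X) :
    𝒢.lux A n f x ≤ M := by
  refine sInf_le ?_
  have : ∀ y, A (f y / M) = 0 := fun y =>
    hA1 _ (ENNReal.div_le_of_le_mul (by rw [one_mul]; exact hf y))
  simp [this]

lemma vol_lt_of_lt_lux {n : ℕ} {x : X} {lam : ℝ≥0∞} (h : lam < 𝒢.lux A n f x) :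
    𝒢.vol n < ∫⁻ y in 𝒢.cell n x, A (f y / lam) ∂μ := by
  by_contra h'
  have h'' : 𝒢.lux A n f x ≤ lam := sInf_le (not_lt.1 h')
  exact absurd h'' (not_le.2 h)

lemma le_vol_of_lux_lt (hA : Monotone A) {n : ℕ} {x : X} {lam : ℝ≥0∞}
    (h : 𝒢.lux A n f x < lam) : ∫⁻ y in 𝒢.cell n x, A (f y / lam) ∂μ ≤ 𝒢.vol n := by
  obtain ⟨l, hl, hl'⟩ := sInf_lt_iff.1 h
  refine le_trans (lintegral_mono fun y => hA ?_) hl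
  gcongr

lemma lux_eq_zero (hA1 : ∀ t ≤ 1, A t = 0) {n : ℕ} {x : X} (h : ∀ y ∈ 𝒢.cell n x, f y = 0)
    (hC : MeasurableSet (𝒢.cell n x)) : 𝒢.lux A n f x = 0 := by
  refine le_antisymm (sInf_le ?_) zero_le
  change ∫⁻ y in 𝒢.cell n x, A (f y / 0) ∂μ ≤ 𝒢.vol n
  rw [setLIntegral_congr_fun (g := fun _ => 0) hC fun y hy => by
    simp [h y hy, hA1 0 zero_le_one]]
  simp

variable [DiscreteMeasurableSpace ι] [SFinite μ] [Countable ι]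

/-- Strong-type bound for the fractional Orlicz maximal operator of a nested family of
partitions. -/
theorem lintegral_sup_lux_rpow_le [Nonempty X] (hA : Monotone A) (hA1 : ∀ t ≤ 1, A t = 0)
    {p q : ℝ} (hp : 1 < p) (hpq : p ≤ q)
    (hf : Measurable f) {M : ℝ≥0∞} (hM : M ≠ ⊤) (hfM : ∀ x, f x ≤ M)
    {D : Set X} (hD : MeasurableSet D) (hμD : μ D ≠ ⊤)
    (hfD : ∀ x y, 𝒢.idx 0 x = 𝒢.idx 0 y → f y ≠ 0 → x ∈ D) (L : ℕ) :
    ∫⁻ x, ((Finset.range (L + 1)).sup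
        fun n => 𝒢.vol n ^ (1 / p - 1 / q) * 𝒢.lux A n f x) ^ q ∂μ ≤
      2 ^ q * (2 ^ (q + 1) * 2 ^ q * bumpTail A q (q / p) 0) * (∫⁻ x, f x ^ p ∂μ) ^ (q / p) := by
  have hp0 : 0 < p := by linarith
  have hq0 : 0 < q := by linarith
  set r := q / p with hr
  have hr0 : 0 < r := by positivity
  have hr1 : 1 ≤ r := (one_le_div hp0).2 hpq
  have he : 0 ≤ 1 / p - 1 / q := sub_nonneg.2 (one_div_le_one_div_of_le hp0 hpq)
  set c : ℕ → ℝ≥0∞ := fun n => 𝒢.vol n ^ (1 / p - 1 / q) with hc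
  have hc0 : ∀ n, c n ≠ 0 := fun n =>
    (ENNReal.rpow_pos (pos_iff_ne_zero.2 (𝒢.vol_ne_zero n)) (𝒢.vol_ne_top n)).ne'
  have hct : ∀ n, c n ≠ ⊤ := fun n => ENNReal.rpow_ne_top_of_nonneg he (𝒢.vol_ne_top n)
  have hca : Antitone c := fun _ _ h => ENNReal.rpow_le_rpow (𝒢.vol_antitone h) he
  have hlM : ∀ n x, 𝒢.lux A n f x ≤ M := 𝒢.lux_le hA1 hfM
  have hlt : ∀ n x, 𝒢.lux A n f x ≠ ⊤ := fun n x => ((hlM n x).trans_lt hM.lt_top).ne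
  set m : ℕ → X → ℝ≥0∞ := fun n x => c n * 𝒢.lux A n f x with hm
  have hmC : ∀ n, 𝒢.CellConst n (m n) := fun n x y h => by
    simp only [hm, 𝒢.cellConst_lux A n f x y h]
  set k : ℕ → X → ℝ≥0∞ := fun n x =>
    if lastJump (fun j => m j x) n = n then m n x ^ q else 0 with hk
  have hkC : ∀ n, 𝒢.CellConst n (k n) := fun n x y h => by
    have h1 := 𝒢.cellConst_lastJump hmC n x y h
    simp only at h1
    simp only [hk, h1, hmC n x y h]
  set g : ℕ → X → ℝ≥0∞ := fun n y => A (2 * f y / 𝒢.lux A n f y) with hg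
  have hgm : ∀ n, Measurable (g n) := fun n =>
    hA.measurable.comp ((hf.const_mul 2).div (𝒢.cellConst_lux A n f).measurable)
  set S := ∑ n ∈ Finset.range (L + 1), ∫⁻ x, k n x ∂μ with hS
  set C₁ := 2 ^ (q + 1) * 2 ^ q * bumpTail A q r 0 with hC₁
  have hkg (n : ℕ) : ∫⁻ x, k n x ∂μ ≤ ∫⁻ x, k n x * g n x ∂μ := by
    rw [← 𝒢.lintegral_mul_avg (hkC n) (hgm n)]
    refine lintegral_mono fun x => ?_
    rcases eq_or_ne (𝒢.lux A n f x) 0 with h0 | h0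
    · simp [hk, hm, h0, hq0]
    have h1 := (𝒢.vol_lt_of_lt_lux (ENNReal.half_lt_self h0 (hlt n x))).le
    have h2 : ∫⁻ y in 𝒢.cell n x, A (f y / (𝒢.lux A n f x / 2)) ∂μ =
        ∫⁻ y in 𝒢.cell n x, g n y ∂μ := by
      refine setLIntegral_congr_fun (𝒢.measurableSet_cell n x) fun y hy => ?_
      simp only [hg]
      rw [𝒢.cellConst_lux A n f y x hy, ENNReal.div_eq_inv_mul, ENNReal.inv_div (by simp) (by simp),
        ENNReal.div_eq_inv_mul, ENNReal.div_eq_inv_mul]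
      ring_nf
    rw [h2] at h1
    refine le_mul_of_one_le_right' ?_
    rw [avg, ENNReal.le_div_iff_mul_le (Or.inl (𝒢.vol_ne_zero n)) (Or.inl (𝒢.vol_ne_top n)),
      one_mul]
    exact h1
  have hwS (x : X) : ∑ n ∈ Finset.range (L + 1), k n x * 𝒢.vol n ≤ S := by
    refine Finset.sum_le_sum fun n _ => ?_
    calc k n x * 𝒢.vol n = ∫⁻ y in 𝒢.cell n x, k n y ∂μ := by
          rw [setLIntegral_congr_fun (g := fun _ => k n x) (𝒢.measurableSet_cell n x)
            fun y hy => hkC n y x hy, setLIntegral_const]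
          rw [cell, 𝒢.measure_cell]
      _ ≤ _ := setLIntegral_le_lintegral _ _
  have hpt (x : X) : ∑ n ∈ Finset.range (L + 1), k n x * g n x ≤
      S ^ (1 - r⁻¹) * (C₁ ^ r⁻¹ * f x ^ p) := by
    have h1 := ENNReal.inner_le_weight_mul_Lp_of_nonneg (Finset.range (L + 1)) hr1
      (fun n => k n x * 𝒢.vol n) (fun n => g n x / 𝒢.vol n)
    have h2 : ∑ n ∈ Finset.range (L + 1), k n x * g n x =
        ∑ n ∈ Finset.range (L + 1), k n x * 𝒢.vol n * (g n x / 𝒢.vol n) := by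
      refine Finset.sum_congr rfl fun n _ => ?_
      rw [mul_assoc, ENNReal.mul_div_cancel (𝒢.vol_ne_zero n) (𝒢.vol_ne_top n)]
    have h3 : ∑ n ∈ Finset.range (L + 1), k n x * 𝒢.vol n * (g n x / 𝒢.vol n) ^ r ≤
        C₁ * f x ^ q := by
      have h4 := sum_jumps_le_bumpTail (q := q) (r := r) hA hA1 hq0 hr0
        ((hfM x).trans_lt hM.lt_top).ne (fun n => hlt n x) hca hc0 hct L
      calc _ = ∑ n ∈ Finset.range (L + 1), (if lastJump (fun j => c j * 𝒢.lux A j f x) n = n then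
            𝒢.lux A n f x ^ q * A (2 * f x / 𝒢.lux A n f x) ^ r else 0) := by
            refine Finset.sum_congr rfl fun n _ => ?_
            simp only [hk, hm, hg]
            split_ifs with hj
            · have hv0 := 𝒢.vol_ne_zero n
              have hvt := 𝒢.vol_ne_top n
              have h5 : c n ^ q * 𝒢.vol n * (𝒢.vol n)⁻¹ ^ r = 1 := by
                simp only [hc]
                rw [← ENNReal.rpow_mul, ENNReal.inv_rpow, ← ENNReal.rpow_neg]
                nth_rewrite 2 [← ENNReal.rpow_one (𝒢.vol n)]
                rw [← ENNReal.rpow_add _ _ hv0 hvt, ← ENNReal.rpow_add _ _ hv0 hvt]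
                have : (1 / p - 1 / q) * q + 1 + -r = 0 := by rw [hr]; field_simp; ring
                rw [this, ENNReal.rpow_zero]
              rw [ENNReal.mul_rpow_of_nonneg _ _ hq0.le, div_eq_mul_inv (A _),
                ENNReal.mul_rpow_of_nonneg _ _ hr0.le]
              calc _ = (c n ^ q * 𝒢.vol n * (𝒢.vol n)⁻¹ ^ r) * (𝒢.lux A n f x ^ q *
                    A (2 * f x / 𝒢.lux A n f x) ^ r) := by ring
                _ = _ := by rw [h5, one_mul]
            · simp
        _ ≤ _ := h4
        _ ≤ 2 ^ (q + 1) * (2 * f x) ^ q * bumpTail A q r 0 := by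
            gcongr
            exact bumpTail_anti zero_le
        _ = C₁ * f x ^ q := by
            rw [ENNReal.mul_rpow_of_nonneg _ _ hq0.le, hC₁]; ring
    rw [h2]
    refine h1.trans ?_
    have h6 : C₁ ^ r⁻¹ * f x ^ p = (C₁ * f x ^ q) ^ r⁻¹ := by
      rw [ENNReal.mul_rpow_of_nonneg C₁ (f x ^ q) (by positivity), ← ENNReal.rpow_mul]
      congr 2
      rw [hr]; field_simp
    rw [h6]
    gcongr
    · exact sub_nonneg.2 (inv_le_one_of_one_le₀ hr1)
    · exact hwS x
  have hkm : ∀ n, Measurable (k n) := fun n => (hkC n).measurable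
  have hmain : S ≤ S ^ (1 - r⁻¹) * (C₁ ^ r⁻¹ * ∫⁻ x, f x ^ p ∂μ) := by
    calc S ≤ ∑ n ∈ Finset.range (L + 1), ∫⁻ x, k n x * g n x ∂μ :=
          Finset.sum_le_sum fun n _ => hkg n
      _ = ∫⁻ x, ∑ n ∈ Finset.range (L + 1), k n x * g n x ∂μ :=
          (lintegral_finsetSum _ fun n _ => (hkm n).mul (hgm n)).symm
      _ ≤ ∫⁻ x, S ^ (1 - r⁻¹) * (C₁ ^ r⁻¹ * f x ^ p) ∂μ := lintegral_mono hpt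
      _ = _ := by
          rw [lintegral_const_mul _ ((hf.pow_const p).const_mul _),
            lintegral_const_mul _ (hf.pow_const p)]
  have hSt : S ≠ ⊤ := by
    refine ENNReal.sum_ne_top.2 fun n _ => ?_
    have hle (x : X) : k n x ≤ D.indicator (fun _ => (c n * M) ^ q) x := by
      by_cases hx : x ∈ D
      · rw [Set.indicator_of_mem hx]
        simp only [hk]
        split_ifs
        · exact ENNReal.rpow_le_rpow (mul_le_mul' le_rfl (hlM n x)) hq0.le
        · exact zero_le
      · have h0 : 𝒢.lux A n f x = 0 := by
          refine 𝒢.lux_eq_zero hA1 (fun y hy => ?_) (𝒢.measurableSet_cell n x)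
          by_contra hy0
          exact hx (hfD x y (𝒢.idx_eq_of_le (Nat.zero_le n) (Eq.symm hy)) hy0)
        simp [hk, hm, h0, hq0]
    refine ((lintegral_mono hle).trans_lt ?_).ne
    rw [lintegral_indicator hD, setLIntegral_const]
    exact ENNReal.mul_lt_top
      (ENNReal.rpow_lt_top_of_nonneg hq0.le (ENNReal.mul_ne_top (hct n) hM)) hμD.lt_top
  have hfin : S ≤ C₁ * (∫⁻ x, f x ^ p ∂μ) ^ r := by
    rcases eq_or_ne S 0 with h0 | h0
    · rw [h0]; exact zero_le
    have h1 : S = S ^ (1 - r⁻¹) * S ^ r⁻¹ := by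
      rw [← ENNReal.rpow_add _ _ h0 hSt]; simp
    have h2 : S ^ r⁻¹ ≤ C₁ ^ r⁻¹ * ∫⁻ x, f x ^ p ∂μ := by
      nth_rewrite 1 [h1] at hmain
      refine (ENNReal.mul_le_mul_iff_right ?_ ?_).1 hmain
      · exact (ENNReal.rpow_pos (pos_iff_ne_zero.2 h0) hSt).ne'
      · exact ENNReal.rpow_ne_top_of_nonneg (sub_nonneg.2 (inv_le_one_of_one_le₀ hr1)) hSt
    have h3 := ENNReal.rpow_le_rpow h2 hr0.le
    rwa [← ENNReal.rpow_mul, inv_mul_cancel₀ hr0.ne', ENNReal.rpow_one,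
      ENNReal.mul_rpow_of_nonneg _ _ hr0.le, ← ENNReal.rpow_mul, inv_mul_cancel₀ hr0.ne',
      ENNReal.rpow_one] at h3
  calc _ ≤ ∫⁻ x, 2 ^ q * ∑ n ∈ Finset.range (L + 1), k n x ∂μ :=
        lintegral_mono fun x => sup_rpow_le_sum_jumps (fun n => m n x) hq0.le L
    _ = 2 ^ q * S := by
        rw [lintegral_const_mul _ (Finset.measurable_sum _ fun n _ => hkm n),
          lintegral_finsetSum _ fun n _ => hkm n]
    _ ≤ _ := by rw [mul_assoc (2 ^ q)]; gcongr

end UniformGrid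

/-- The constant in the bound for the Orlicz maximal operator. -/
def bumpConst (A : ℝ≥0∞ → ℝ≥0∞) (q r : ℝ) : ℝ≥0∞ :=
  2 ^ q * (2 ^ (q + 1) * 2 ^ q * bumpTail A q r 0)

namespace UniformGrid

variable {X ι : Type*} [MeasurableSpace X] {μ : Measure X} [MeasurableSpace ι]
  (𝒢 : UniformGrid μ ι) [DiscreteMeasurableSpace ι] [SFinite μ] [Countable ι]

/-- The bilinear form of a dyadic fractional integral, under a mixed bump condition. -/
theorem sum_lintegral_mul_avg_le_of_lux [Nonempty X] {A B : ℝ≥0∞ → ℝ≥0∞} (hA : Monotone A)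
    (hA1 : ∀ t ≤ 1, A t = 0) (hB : Monotone B) (hB1 : ∀ t ≤ 1, B t = 0)
    {p q q' : ℝ} (hp : 1 < p) (hpq : p ≤ q) (hqq : q.HolderConjugate q')
    {f h F G : X → ℝ≥0∞} (hf : Measurable f) (hh : Measurable h)
    (hF : Measurable F) (hG : Measurable G) (hGi : ∫⁻ x, G x ∂μ ≠ ⊤)
    {M : ℝ≥0∞} (hM : M ≠ ⊤) (hfM : ∀ x, f x ≤ M) (hhM : ∀ x, h x ≤ M)
    {D : Set X} (hD : MeasurableSet D) (hμD : μ D ≠ ⊤)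
    (hfD : ∀ x y, 𝒢.idx 0 x = 𝒢.idx 0 y → f y ≠ 0 → x ∈ D)
    (hhD : ∀ x y, 𝒢.idx 0 x = 𝒢.idx 0 y → h y ≠ 0 → x ∈ D)
    (l : ℕ → ℝ≥0∞) (hl : ∀ n, 2 * l (n + 1) = l n) {K : ℝ≥0∞}
    (hK : ∀ n x, l n * 𝒢.avg n F x * 𝒢.avg n G x ≤
      K * (𝒢.vol n ^ (1 / p - 1 / q) * 𝒢.lux A n f x * 𝒢.lux B n h x)) (L : ℕ) :
    ∑ n ∈ Finset.range (L + 1), ∫⁻ x, l n * (G x * 𝒢.avg n F x) ∂μ ≤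
      8 * K * (bumpConst A q (q / p) ^ (1 / q) * bumpConst B q' 1 ^ (1 / q')) *
        ((∫⁻ x, f x ^ p ∂μ) ^ (1 / p) * (∫⁻ x, h x ^ q' ∂μ) ^ (1 / q')) := by
  have hp0 : 0 < p := by linarith
  have hq0 : 0 < q := hqq.pos
  have hq0' : 0 < q' := hqq.symm.pos
  set mf : X → ℝ≥0∞ := fun x =>
    (Finset.range (L + 1)).sup fun n => 𝒢.vol n ^ (1 / p - 1 / q) * 𝒢.lux A n f x
  set mh : X → ℝ≥0∞ := fun x =>
    (Finset.range (L + 1)).sup fun n => 𝒢.vol n ^ (1 / q' - 1 / q') * 𝒢.lux B n h x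
  have hsup {A' : ℝ≥0∞ → ℝ≥0∞} {e : ℝ} {f' : X → ℝ≥0∞} : Measurable fun x =>
      (Finset.range (L + 1)).sup fun n => 𝒢.vol n ^ e * 𝒢.lux A' n f' x := by
    refine CellConst.measurable (𝒢 := 𝒢) (n := L) fun x y hxy =>
      Finset.sup_congr rfl fun n hn => ?_
    rw [(𝒢.cellConst_lux A' n f').mono (Nat.lt_succ_iff.1 (Finset.mem_range.1 hn)) x y hxy]
  have hmf : Measurable mf := hsup
  have hmh : Measurable mh := hsup
  have h1 := 𝒢.lintegral_sup_lux_rpow_le hA hA1 hp hpq hf hM hfM hD hμD hfD L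
  have h2 := 𝒢.lintegral_sup_lux_rpow_le hB hB1 hqq.symm.lt le_rfl hh hM hhM hD hμD hhD L
  rw [div_self hq0'.ne', ENNReal.rpow_one] at h2
  have h3 : (∫⁻ x, mf x ^ q ∂μ) ^ (1 / q) ≤
      bumpConst A q (q / p) ^ (1 / q) * (∫⁻ x, f x ^ p ∂μ) ^ (1 / p) := by
    refine (ENNReal.rpow_le_rpow h1 (by positivity)).trans_eq ?_
    rw [ENNReal.mul_rpow_of_nonneg _ _ (by positivity), ← ENNReal.rpow_mul, bumpConst]
    congr 2
    field_simp
  have h4 : (∫⁻ x, mh x ^ q' ∂μ) ^ (1 / q') ≤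
      bumpConst B q' 1 ^ (1 / q') * (∫⁻ x, h x ^ q' ∂μ) ^ (1 / q') := by
    refine (ENNReal.rpow_le_rpow h2 (by positivity)).trans_eq ?_
    rw [ENNReal.mul_rpow_of_nonneg _ _ (by positivity), bumpConst]
  calc _ ≤ 8 * ∫⁻ x, (Finset.range (L + 1)).sup
        (fun n => l n * 𝒢.avg n F x * 𝒢.avg n G x) ∂μ :=
        𝒢.sum_lintegral_mul_avg_le hF hG hGi l hl L
    _ ≤ 8 * ∫⁻ x, K * (mf x * mh x) ∂μ := by
        gcongr with x
        refine Finset.sup_le fun n hn => (hK n x).trans ?_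
        gcongr
        · exact Finset.le_sup (f := fun n => 𝒢.vol n ^ (1 / p - 1 / q) * 𝒢.lux A n f x) hn
        · refine le_trans ?_ (Finset.le_sup
            (f := fun n => 𝒢.vol n ^ (1 / q' - 1 / q') * 𝒢.lux B n h x) hn)
          simp
    _ = 8 * K * ∫⁻ x, (mf * mh) x ∂μ := by
        have := lintegral_const_mul (μ := μ) K (hmf.mul hmh)
        rw [mul_assoc, ← this]; rfl
    _ ≤ 8 * K * ((∫⁻ x, mf x ^ q ∂μ) ^ (1 / q) * (∫⁻ x, mh x ^ q' ∂μ) ^ (1 / q')) := by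
        gcongr
        exact ENNReal.lintegral_mul_le_Lp_mul_Lq μ hqq hmf.aemeasurable hmh.aemeasurable
    _ ≤ 8 * K * ((bumpConst A q (q / p) ^ (1 / q) * (∫⁻ x, f x ^ p ∂μ) ^ (1 / p)) *
        (bumpConst B q' 1 ^ (1 / q') * (∫⁻ x, h x ^ q' ∂μ) ^ (1 / q'))) := by gcongr
    _ = _ := by ring

end UniformGrid

/-- The associate function as a function on `[0, ∞]`, truncated to vanish on `[0, 1]`. -/
def assocE (Φ : ℝ → ℝ) (t : ℝ≥0∞) : ℝ≥0∞ :=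
  if t ≤ 1 then 0 else if t = ⊤ then ⊤ else ENNReal.ofReal (assoc Φ t.toReal)

section Young

variable {Φ : ℝ → ℝ}

lemma young_nonneg (hΦ : IsYoungFunction Φ) {s : ℝ} (hs : 0 ≤ s) : 0 ≤ Φ s := by
  rw [← hΦ.map_zero]
  exact hΦ.monotoneOn Set.self_mem_Ici hs hs

lemma bddAbove_assoc (hΦ : IsYoungFunction Φ) (t : ℝ) :
    BddAbove ((fun s => s * t - Φ s) '' Set.Ioi (0 : ℝ)) := by
  obtain ⟨N, hN⟩ := Filter.eventually_atTop.1 (hΦ.tendsto.eventually_ge_atTop t)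
  refine ⟨|N| * |t|, ?_⟩
  rintro _ ⟨s, hs, rfl⟩
  have hs' : 0 < s := hs
  rcases le_total N s with h | h
  · have h1 : t * s ≤ Φ s := (le_div_iff₀ hs').1 (hN s h)
    have : 0 ≤ |N| * |t| := by positivity
    simp only
    linarith
  · have h1 : s * t ≤ |N| * |t| := by
      refine (le_abs_self _).trans ?_
      rw [abs_mul]
      gcongr
    have h2 := young_nonneg hΦ hs'.le
    simp only
    linarith

lemma young_inequality (hΦ : IsYoungFunction Φ) {s : ℝ} (hs : 0 < s) (t : ℝ) :
    s * t ≤ Φ s + assoc Φ t := by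
  have : s * t - Φ s ≤ assoc Φ t := le_csSup (bddAbove_assoc hΦ t) ⟨s, hs, rfl⟩
  linarith

lemma assoc_mono (hΦ : IsYoungFunction Φ) : Monotone (assoc Φ) := by
  intro t t' h
  refine csSup_le (Set.Nonempty.image _ Set.nonempty_Ioi) ?_
  rintro _ ⟨s, hs, rfl⟩
  have hs' : 0 < s := hs
  have h1 := young_inequality hΦ hs' t'
  have h2 : s * t ≤ s * t' := by gcongr
  simp only
  linarith

lemma assoc_nonneg (hΦ : IsYoungFunction Φ) {t : ℝ} (ht : 0 ≤ t) : 0 ≤ assoc Φ t := by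
  have h1 : 0 ≤ Φ 1 := young_nonneg hΦ zero_le_one
  refine le_of_forall_pos_sub_le fun ε hε => ?_
  obtain ⟨s, hs0, hs1, hsε⟩ : ∃ s, 0 < s ∧ s ≤ 1 ∧ s * Φ 1 ≤ ε := by
    refine ⟨min 1 (ε / (Φ 1 + 1)), by positivity, min_le_left _ _, ?_⟩
    calc _ ≤ ε / (Φ 1 + 1) * (Φ 1 + 1) := by
          gcongr
          · exact min_le_right _ _
          · linarith
      _ = ε := by field_simp
  have h2 := young_inequality hΦ hs0 t
  have h3 : Φ s ≤ s * Φ 1 := by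
    have := hΦ.convexOn.2 (Set.self_mem_Ici (a := (0 : ℝ))) (Set.mem_Ici.2 zero_le_one)
      (sub_nonneg.2 hs1) hs0.le (by ring)
    simpa [hΦ.map_zero] using this
  have h4 : 0 ≤ s * t := by positivity
  linarith

lemma assocE_mono (hΦ : IsYoungFunction Φ) : Monotone (assocE Φ) := by
  intro t t' h
  rw [assocE, assocE]
  by_cases h1 : t ≤ 1
  · simp [h1]
  have h1' : ¬ t' ≤ 1 := fun h' => h1 (h.trans h')
  rw [if_neg h1, if_neg h1']
  by_cases h2 : t' = ⊤
  · simp [h2]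
  · have h3 : t ≠ ⊤ := (h.trans_lt (lt_top_iff_ne_top.2 h2)).ne
    rw [if_neg h2, if_neg h3]
    exact ENNReal.ofReal_le_ofReal (assoc_mono hΦ (ENNReal.toReal_mono h2 h))

lemma assocE_of_le_one {t : ℝ≥0∞} (ht : t ≤ 1) : assocE Φ t = 0 := if_pos ht

lemma bumpTail_assocE_le (hΦ : IsYoungFunction Φ) {q r : ℝ} (hr : 0 < r) :
    bumpTail (assocE Φ) q r 0 ≤
      ∫⁻ t in Set.Ioi (1 : ℝ), ENNReal.ofReal (assoc Φ t ^ r / t ^ (q + 1)) := by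
  rw [bumpTail, ← lintegral_indicator measurableSet_Ioi]
  refine (setLIntegral_le_lintegral _ _).trans (lintegral_mono fun s => ?_)
  rcases le_or_gt s 1 with hs | hs
  · have : ENNReal.ofReal s ≤ 1 := ENNReal.ofReal_le_one.2 hs
    simp [bumpDensity, assocE_of_le_one this, hr]
  · have hs0 : 0 < s := by linarith
    have h1 : ¬ ENNReal.ofReal s ≤ 1 := by rw [ENNReal.ofReal_le_one]; linarith
    rw [Set.indicator_of_mem (Set.mem_Ioi.2 hs), bumpDensity, assocE, if_neg h1,
      if_neg ENNReal.ofReal_ne_top, ENNReal.toReal_ofReal hs0.le,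
      ENNReal.ofReal_rpow_of_nonneg (assoc_nonneg hΦ hs0.le) hr.le,
      ENNReal.ofReal_rpow_of_pos hs0, ← ENNReal.ofReal_mul
        (Real.rpow_nonneg (assoc_nonneg hΦ hs0.le) _), Real.rpow_neg hs0.le, div_eq_mul_inv]

lemma bumpConst_ne_top {q r : ℝ} (hq : 0 < q) {A : ℝ≥0∞ → ℝ≥0∞} (h : bumpTail A q r 0 < ⊤) :
    bumpConst A q r ≠ ⊤ := by
  have h2 : ∀ e : ℝ, 0 ≤ e → (2 : ℝ≥0∞) ^ e ≠ ⊤ := fun e he =>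
    ENNReal.rpow_ne_top_of_nonneg he (by simp)
  exact ENNReal.mul_ne_top (h2 q hq.le) (ENNReal.mul_ne_top
    (ENNReal.mul_ne_top (h2 _ (by positivity)) (h2 q hq.le)) h.ne)

lemma bumpConst_ne_top_of_memBpq (hΦ : IsYoungFunction Φ) {p q : ℝ} (hp : 0 < p) (hq : 0 < q)
    (h : MemBpq (assoc Φ) p q) : bumpConst (assocE Φ) q (q / p) ≠ ⊤ :=
  bumpConst_ne_top hq ((bumpTail_assocE_le hΦ (by positivity)).trans_lt h)

lemma bumpConst_ne_top_of_memBp (hΦ : IsYoungFunction Φ) {q : ℝ} (hq : 0 < q)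
    (h : MemBp (assoc Φ) q) : bumpConst (assocE Φ) q 1 ≠ ⊤ := by
  refine bumpConst_ne_top hq ((bumpTail_assocE_le hΦ one_pos).trans_lt ?_)
  simpa [MemBp] using h

lemma ofReal_mul_le_young (hΦ : IsYoungFunction Φ) {a : ℝ} (ha : 0 ≤ a) {b lam κ : ℝ≥0∞}
    (hb : b ≠ ⊤) (hl0 : lam ≠ 0) (hlt : lam ≠ ⊤) (hκ0 : κ ≠ 0) (hκt : κ ≠ ⊤) :
    ENNReal.ofReal a * b ≤ lam * κ * (ENNReal.ofReal (Φ (a / lam.toReal)) +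
      ENNReal.ofReal (assoc Φ 1) + assocE Φ (b / κ)) := by
  have hl : 0 < lam.toReal := ENNReal.toReal_pos hl0 hlt
  rcases ha.eq_or_lt with rfl | ha
  · simp
  have hs : 0 < a / lam.toReal := by positivity
  set t := b / κ with ht
  have htt : t ≠ ⊤ := (ENNReal.div_lt_top hb hκ0).ne
  have h1 : ENNReal.ofReal a * b = lam * κ * (ENNReal.ofReal (a / lam.toReal * t.toReal)) := by
    rw [ENNReal.ofReal_mul hs.le, ENNReal.ofReal_div_of_pos hl, ENNReal.ofReal_toReal hlt,
      ENNReal.ofReal_toReal htt]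
    calc _ = (lam * (ENNReal.ofReal a / lam)) * (κ * (b / κ)) := by
          rw [ENNReal.mul_div_cancel hl0 hlt, ENNReal.mul_div_cancel hκ0 hκt]
      _ = _ := by rw [ht]; ring
  rw [h1]
  refine mul_le_mul' le_rfl ?_
  have h2 := young_inequality hΦ hs t.toReal
  have h3 : 0 ≤ Φ (a / lam.toReal) := young_nonneg hΦ hs.le
  refine (ENNReal.ofReal_le_ofReal h2).trans ?_
  rw [ENNReal.ofReal_add h3 (assoc_nonneg hΦ ENNReal.toReal_nonneg), add_assoc]
  refine add_le_add le_rfl ?_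
  by_cases h4 : t ≤ 1
  · refine le_trans (ENNReal.ofReal_le_ofReal (assoc_mono hΦ ?_)) le_self_add
    simpa using ENNReal.toReal_mono ENNReal.one_ne_top h4
  · rw [assocE, if_neg h4, if_neg htt]
    exact le_add_self

lemma luxNorm_eq_sInf {d : ℕ} (Q : Cube d) {w : Rd d → ℝ} (hw : ∀ x, 0 ≤ w x) :
    luxNorm Φ Q w = sInf {lam : ℝ≥0∞ | 0 < lam ∧ lam < ⊤ ∧
      (∫⁻ x in Q.set, ENNReal.ofReal (Φ (w x / lam.toReal))) ≤ ENNReal.ofReal Q.vol} := by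
  have (x : Rd d) : (ENNReal.ofReal |w x|).toReal = w x := by
    rw [ENNReal.toReal_ofReal (abs_nonneg _), abs_of_nonneg (hw x)]
  simp only [luxNorm, luxNormE, this]

end Young

variable {d : ℕ} {ι : Type*} [MeasurableSpace ι]
  (𝒢 : UniformGrid (volume : Measure (Rd d)) ι)

lemma avg_le_luxNorm_mul_lux {Φ : ℝ → ℝ} (hΦ : IsYoungFunction Φ) {n : ℕ} {x : Rd d} {Q : Cube d}
    (hQ : 𝒢.cell n x = Q.set) (hv : 𝒢.vol n = ENNReal.ofReal Q.vol)
    {w : Rd d → ℝ} (hw : ∀ x, 0 ≤ w x) {f F : Rd d → ℝ≥0∞} (hf : Measurable f)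
    (hft : ∀ x, f x ≠ ⊤) (hF : ∀ x, F x ≤ ENNReal.ofReal (w x) * f x)
    (hl : 𝒢.lux (assocE Φ) n f x ≠ ⊤) (hN : luxNorm Φ Q w ≠ ⊤) :
    𝒢.avg n F x ≤ (2 + ENNReal.ofReal (assoc Φ 1)) *
      (luxNorm Φ Q w * 𝒢.lux (assocE Φ) n f x) := by
  set c := 2 + ENNReal.ofReal (assoc Φ 1) with hc
  have hc0 : c ≠ 0 := by simp [hc]
  have hct : c ≠ ⊤ := by simp [hc]
  rw [luxNorm_eq_sInf Q hw] at hN ⊢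
  set S := {lam : ℝ≥0∞ | 0 < lam ∧ lam < ⊤ ∧
      (∫⁻ x in Q.set, ENNReal.ofReal (Φ (w x / lam.toReal))) ≤ ENNReal.ofReal Q.vol} with hS
  set l := 𝒢.lux (assocE Φ) n f x with hldef
  have key {lam κ : ℝ≥0∞} (hlam : lam ∈ S) (hκ : l < κ) (hκt : κ ≠ ⊤) :
      𝒢.avg n F x ≤ c * lam * κ := by
    obtain ⟨h0, ht, hle⟩ := hlam
    have hκ0 : κ ≠ 0 := (zero_le.trans_lt hκ).ne'
    have h1 := 𝒢.le_vol_of_lux_lt (assocE_mono hΦ) hκ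
    rw [UniformGrid.avg, ENNReal.div_le_iff_le_mul (Or.inl (𝒢.vol_ne_zero n))
      (Or.inl (𝒢.vol_ne_top n))]
    calc ∫⁻ y in 𝒢.cell n x, F y ≤ ∫⁻ y in 𝒢.cell n x, lam * κ *
          (ENNReal.ofReal (Φ (w y / lam.toReal)) + ENNReal.ofReal (assoc Φ 1) +
            assocE Φ (f y / κ)) :=
          lintegral_mono fun y => (hF y).trans
            (ofReal_mul_le_young hΦ (hw y) (hft y) h0.ne' ht.ne hκ0 hκt)
      _ = lam * κ * ((∫⁻ y in 𝒢.cell n x, ENNReal.ofReal (Φ (w y / lam.toReal))) +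
            ENNReal.ofReal (assoc Φ 1) * 𝒢.vol n +
            ∫⁻ y in 𝒢.cell n x, assocE Φ (f y / κ)) := by
          have hm : Measurable fun y => assocE Φ (f y / κ) :=
            (assocE_mono hΦ).measurable.comp (hf.div_const κ)
          rw [lintegral_const_mul' _ _ (ENNReal.mul_ne_top ht.ne hκt), lintegral_add_right _ hm,
            lintegral_add_right _ measurable_const, setLIntegral_const]
          congr 4
          exact 𝒢.measure_cell n x
      _ ≤ lam * κ * (𝒢.vol n + ENNReal.ofReal (assoc Φ 1) * 𝒢.vol n + 𝒢.vol n) := by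
          gcongr
          rw [hQ, hv]; exact hle
      _ = c * lam * κ * 𝒢.vol n := by rw [hc]; ring
  have key2 {lam : ℝ≥0∞} (hlam : lam ∈ S) : 𝒢.avg n F x ≤ lam * (c * l) := by
    have hcl0 : c * lam ≠ 0 := mul_ne_zero hc0 hlam.1.ne'
    have hclt : c * lam ≠ ⊤ := ENNReal.mul_ne_top hct hlam.2.1.ne
    have : 𝒢.avg n F x / (c * lam) ≤ l := by
      refine le_of_forall_gt_imp_ge_of_dense fun κ hκ => ?_
      rcases eq_or_ne κ ⊤ with rfl | hκt
      · exact le_top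
      exact ENNReal.div_le_of_le_mul' (key hlam hκ hκt)
    rw [ENNReal.div_le_iff_le_mul (Or.inl hcl0) (Or.inl hclt)] at this
    exact this.trans_eq (by ring)
  have hne : S.Nonempty := by
    by_contra h
    rw [Set.not_nonempty_iff_eq_empty] at h
    simp [h] at hN
  rcases eq_or_ne l 0 with h0 | h0
  · obtain ⟨lam, hlam⟩ := hne
    have := key2 hlam
    rw [h0] at this ⊢
    simpa using this
  · have hcl0 : c * l ≠ 0 := mul_ne_zero hc0 h0
    have hclt : c * l ≠ ⊤ := ENNReal.mul_ne_top hct hl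
    have : 𝒢.avg n F x / (c * l) ≤ sInf S :=
      le_sInf fun lam hlam => ENNReal.div_le_of_le_mul (key2 hlam)
    rw [ENNReal.div_le_iff_le_mul (Or.inl hcl0) (Or.inl hclt)] at this
    exact this.trans_eq (by ring)

lemma eq_zero_of_mul_mul_top {a b : ℝ≥0∞} (ha : a ≠ 0) (h : a * b * ⊤ ≠ ⊤) : b = 0 := by
  by_contra hb
  exact h (ENNReal.mul_top (mul_ne_zero ha hb))

/-- The localized form of the mixed bump condition. -/
lemma mul_avg_mul_avg_le {Φ Ψ : ℝ → ℝ} (hΦ : IsYoungFunction Φ) (hΨ : IsYoungFunction Ψ)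
    (hd : d ≠ 0) {n : ℕ} {x : Rd d} {Q : Cube d}
    (hQ : 𝒢.cell n x = Q.set) (hv : 𝒢.vol n = ENNReal.ofReal Q.vol)
    {w v : Rd d → ℝ} (hw : ∀ x, 0 ≤ w x) (hv0 : ∀ x, 0 ≤ v x)
    {f F h G : Rd d → ℝ≥0∞} (hf : Measurable f) (hh : Measurable h)
    {M : ℝ≥0∞} (hM : M ≠ ⊤) (hfM : ∀ x, f x ≤ M) (hhM : ∀ x, h x ≤ M)
    (hF : ∀ x, F x ≤ ENNReal.ofReal (w x) * f x) (hG : ∀ x, G x ≤ ENNReal.ofReal (v x) * h x)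
    {p q : ℝ} {K : ℝ≥0∞} (hK : K ≠ ⊤)
    (hbump : ENNReal.ofReal (Q.vol ^ (1 / (d : ℝ) + 1 / q - 1 / p)) * luxNorm Ψ Q v *
      luxNorm Φ Q w ≤ K) :
    ENNReal.ofReal Q.side * 𝒢.avg n F x * 𝒢.avg n G x ≤
      (2 + ENNReal.ofReal (assoc Φ 1)) * (2 + ENNReal.ofReal (assoc Ψ 1)) * K *
        (𝒢.vol n ^ (1 / p - 1 / q) * 𝒢.lux (assocE Φ) n f x * 𝒢.lux (assocE Ψ) n h x) := by
  have hft : ∀ x, f x ≠ ⊤ := fun x => ((hfM x).trans_lt hM.lt_top).ne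
  have hht : ∀ x, h x ≠ ⊤ := fun x => ((hhM x).trans_lt hM.lt_top).ne
  have hlf : 𝒢.lux (assocE Φ) n f x ≠ ⊤ :=
    ((𝒢.lux_le (fun _ => assocE_of_le_one) hfM n x).trans_lt hM.lt_top).ne
  have hlh : 𝒢.lux (assocE Ψ) n h x ≠ ⊤ :=
    ((𝒢.lux_le (fun _ => assocE_of_le_one) hhM n x).trans_lt hM.lt_top).ne
  have hvol : 0 < Q.vol := pow_pos Q.side_pos d
  set e := 1 / (d : ℝ) + 1 / q - 1 / p with he
  have ha0 : ENNReal.ofReal (Q.vol ^ e) ≠ 0 := by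
    simpa using Real.rpow_pos_of_pos hvol e
  have hat : ENNReal.ofReal (Q.vol ^ e) ≠ ⊤ := ENNReal.ofReal_ne_top
  have hbt := (hbump.trans_lt hK.lt_top).ne
  have avgF := avg_le_luxNorm_mul_lux 𝒢 hΦ hQ hv hw hf hft hF hlf
  have avgG := avg_le_luxNorm_mul_lux 𝒢 hΨ hQ hv hv0 hh hht hG hlh
  by_cases h1 : luxNorm Φ Q w = ⊤
  · rw [h1] at hbt
    have h2 := eq_zero_of_mul_mul_top ha0 hbt
    have h3 := avgG (by simp [h2])
    rw [h2] at h3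
    have : 𝒢.avg n G x = 0 := by simpa using h3
    simp [this]
  by_cases h1' : luxNorm Ψ Q v = ⊤
  · rw [h1', mul_right_comm] at hbt
    have h2 := eq_zero_of_mul_mul_top ha0 hbt
    have h3 := avgF (by simp [h2])
    rw [h2] at h3
    have : 𝒢.avg n F x = 0 := by simpa using h3
    simp [this]
  have hs : ENNReal.ofReal Q.side =
      ENNReal.ofReal (Q.vol ^ e) * 𝒢.vol n ^ (1 / p - 1 / q) := by
    rw [hv, ENNReal.ofReal_rpow_of_pos hvol, ← ENNReal.ofReal_mul (by positivity),
      ← Real.rpow_add hvol]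
    have : e + (1 / p - 1 / q) = (d : ℝ)⁻¹ := by rw [he]; ring
    rw [this, Cube.vol, Real.pow_rpow_inv_natCast Q.side_pos.le hd]
  calc _ ≤ ENNReal.ofReal Q.side *
        ((2 + ENNReal.ofReal (assoc Φ 1)) * (luxNorm Φ Q w * 𝒢.lux (assocE Φ) n f x)) *
        ((2 + ENNReal.ofReal (assoc Ψ 1)) * (luxNorm Ψ Q v * 𝒢.lux (assocE Ψ) n h x)) := by
        gcongr
        · exact avgF h1
        · exact avgG h1'
    _ = (2 + ENNReal.ofReal (assoc Φ 1)) * (2 + ENNReal.ofReal (assoc Ψ 1)) *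
        (ENNReal.ofReal (Q.vol ^ e) * luxNorm Ψ Q v * luxNorm Φ Q w) *
        (𝒢.vol n ^ (1 / p - 1 / q) * 𝒢.lux (assocE Φ) n f x * 𝒢.lux (assocE Ψ) n h x) := by
        rw [hs]; ring
    _ ≤ _ := by gcongr

section Grid

variable {d : ℕ}

lemma volume_cube (Q : Cube d) : volume Q.set = ENNReal.ofReal Q.vol := by
  have h : Q.set = (WithLp.ofLp : Rd d → Fin d → ℝ) ⁻¹'
      (Set.pi Set.univ fun i => Set.Ico (Q.corner i) (Q.corner i + Q.side)) := by
    ext x; simp [Cube.set]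
  rw [h, (PiLp.volume_preserving_ofLp (Fin d)).measure_preimage
    (MeasurableSet.univ_pi fun i => measurableSet_Ico).nullMeasurableSet, Real.volume_pi_Ico]
  simp [Cube.vol, ENNReal.ofReal_pow Q.side_pos.le]

lemma measurableSet_cube (Q : Cube d) : MeasurableSet Q.set := by
  have h : Q.set = (WithLp.ofLp : Rd d → Fin d → ℝ) ⁻¹'
      (Set.pi Set.univ fun i => Set.Ico (Q.corner i) (Q.corner i + Q.side)) := by
    ext x; simp [Cube.set]
  rw [h]
  exact (PiLp.volume_preserving_ofLp (Fin d)).measurable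
    (MeasurableSet.univ_pi fun i => measurableSet_Ico)

/-- The cube with corner `a` and side `s0 / 2 ^ n`, translated by `k` times its side. -/
def gridCube (a : Fin d → ℝ) {s0 : ℝ} (hs : 0 < s0) (n : ℕ) (k : Fin d → ℤ) : Cube d where
  corner i := a i + s0 / 2 ^ n * k i
  side := s0 / 2 ^ n
  side_pos := by positivity

/-- The position of `x` in the translated dyadic grid. -/
def gridIdx (a : Fin d → ℝ) (s0 : ℝ) (n : ℕ) (x : Rd d) : Fin d → ℤ :=
  fun i => ⌊(x i - a i) / (s0 / 2 ^ n)⌋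

lemma setOf_gridIdx_eq (a : Fin d → ℝ) {s0 : ℝ} (hs : 0 < s0) (n : ℕ) (k : Fin d → ℤ) :
    {y | gridIdx a s0 n y = k} = (gridCube a hs n k).set := by
  have hn : 0 < s0 / 2 ^ n := by positivity
  ext y
  simp only [Set.mem_ofPred_eq, funext_iff, gridIdx, Cube.set, gridCube, Int.floor_eq_iff]
  refine forall_congr' fun i => ?_
  rw [le_div_iff₀ hn, div_lt_iff₀ hn]
  constructor <;> rintro ⟨h1, h2⟩ <;> constructor <;> linarith

/-- The dyadic grid translated by `a`, whose largest cubes have side `s0`. -/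
def dyadicGrid (a : Fin d → ℝ) {s0 : ℝ} (hs : 0 < s0) :
    UniformGrid (volume : Measure (Rd d)) (Fin d → ℤ) where
  idx := gridIdx a s0
  measurable_idx n := by
    refine measurable_pi_iff.2 fun i => Int.measurable_floor.comp ?_
    fun_prop
  nested n x y h := by
    have key (t : ℝ) : ⌊t / (s0 / 2 ^ n)⌋ = ⌊t / (s0 / 2 ^ (n + 1))⌋ / (2 : ℕ) := by
      rw [← Int.floor_div_natCast]
      congr 1
      rw [pow_succ]; push_cast; field_simp
    ext i
    have hi := congrFun h i
    simp only [gridIdx] at hi ⊢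
    rw [key, key, hi]
  vol n := ENNReal.ofReal ((s0 / 2 ^ n) ^ d)
  vol_ne_zero n := by
    have : 0 < (s0 / 2 ^ n) ^ d := by positivity
    simpa using this
  vol_ne_top n := ENNReal.ofReal_ne_top
  measure_cell n x := by rw [setOf_gridIdx_eq a hs, volume_cube]; rfl

lemma dyadicGrid_cell (a : Fin d → ℝ) {s0 : ℝ} (hs : 0 < s0) (n : ℕ) (x : Rd d) :
    (dyadicGrid a hs).cell n x = (gridCube a hs n (gridIdx a s0 n x)).set :=
  setOf_gridIdx_eq a hs n _

lemma abs_sub_lt_of_gridIdx_eq {a : Fin d → ℝ} {s0 : ℝ} (hs : 0 < s0) {x y : Rd d}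
    (h : gridIdx a s0 0 x = gridIdx a s0 0 y) (i : Fin d) : |x i - y i| < s0 := by
  have hi := Int.abs_sub_lt_one_of_floor_eq_floor (congrFun h i)
  rw [pow_zero, div_one, ← sub_div, abs_div, abs_of_pos hs, div_lt_one hs] at hi
  simpa using hi

lemma floor_eq_or_floor_sub_eq {s0 : ℝ} (hs : 0 < s0) (n : ℕ) {x y : ℝ}
    (h : 3 * |x - y| < s0 / 2 ^ n) :
    ⌊x / (s0 / 2 ^ n)⌋ = ⌊y / (s0 / 2 ^ n)⌋ ∨
      ⌊(x - s0 / 3) / (s0 / 2 ^ n)⌋ = ⌊(y - s0 / 3) / (s0 / 2 ^ n)⌋ := by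
  wlog hxy : x ≤ y generalizing x y
  · rw [abs_sub_comm] at h
    exact (this h (not_le.1 hxy).le).imp Eq.symm Eq.symm
  have hn : 0 < s0 / 2 ^ n := by positivity
  have key {u v : ℝ} (huv : u ≤ v) (hne : ⌊u⌋ ≠ ⌊v⌋) : u < ⌊v⌋ ∧ (⌊v⌋ : ℝ) ≤ v :=
    ⟨Int.floor_lt.1 (lt_of_le_of_ne (Int.floor_mono huv) hne), Int.floor_le v⟩
  have hsh (t : ℝ) : (t - s0 / 3) / (s0 / 2 ^ n) = t / (s0 / 2 ^ n) - 2 ^ n / 3 := by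
    field_simp
  rw [hsh, hsh]
  have hdist : 3 * (y / (s0 / 2 ^ n) - x / (s0 / 2 ^ n)) < 1 := by
    rw [← sub_div, mul_div_assoc', div_lt_one hn]
    rw [abs_sub_comm, abs_of_nonneg (sub_nonneg.2 hxy)] at h
    exact h
  have hXY : x / (s0 / 2 ^ n) ≤ y / (s0 / 2 ^ n) := by gcongr
  generalize x / (s0 / 2 ^ n) = X at *
  generalize y / (s0 / 2 ^ n) = Y at *
  by_contra! hcon
  obtain ⟨h1, h2⟩ := key hXY hcon.1
  obtain ⟨h3, h4⟩ := key (sub_le_sub_right hXY ((2 : ℝ) ^ n / 3)) hcon.2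
  generalize ⌊Y⌋ = m at *
  generalize ⌊Y - 2 ^ n / 3⌋ = k at *
  have h5 : ((3 * (m - k) - 2 ^ n : ℤ) : ℝ) < 1 := by push_cast; linarith
  have h6 : (-1 : ℝ) < ((3 * (m - k) - 2 ^ n : ℤ) : ℝ) := by push_cast; linarith
  have h7 : (3 * (m - k) - 2 ^ n : ℤ) < 1 := by exact_mod_cast h5
  have h8 : -1 < (3 * (m - k) - 2 ^ n : ℤ) := by exact_mod_cast h6
  have h9 : (2 : ℤ) ^ n = 3 * (m - k) := by omega
  have h10 : (3 : ℤ) ∣ 2 ^ n := ⟨_, h9⟩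
  have := Int.Prime.dvd_pow' (p := 3) (by norm_num) h10
  norm_num at this

/-- The translations of the adjacent dyadic grids. -/
def gridShift (s0 : ℝ) (τ : Fin d → Bool) : Fin d → ℝ := fun i => if τ i then s0 / 3 else 0

lemma exists_gridIdx_eq {s0 : ℝ} (hs : 0 < s0) (n : ℕ) {x y : Rd d}
    (h : 3 * ‖x - y‖ < s0 / 2 ^ n) :
    ∃ τ : Fin d → Bool, gridIdx (gridShift s0 τ) s0 n y = gridIdx (gridShift s0 τ) s0 n x := by
  have hi (i : Fin d) : ∃ b : Bool, ⌊(y i - if b then s0 / 3 else 0) / (s0 / 2 ^ n)⌋ =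
      ⌊(x i - if b then s0 / 3 else 0) / (s0 / 2 ^ n)⌋ := by
    have h1 : |x i - y i| ≤ ‖x - y‖ := by simpa using PiLp.norm_apply_le (x - y) i
    rcases floor_eq_or_floor_sub_eq hs n (x := x i) (y := y i) (by linarith) with h2 | h2
    · exact ⟨false, by simpa using h2.symm⟩
    · exact ⟨true, by simpa using h2.symm⟩
  choose τ hτ using hi
  exact ⟨τ, funext hτ⟩

lemma exists_scale {s0 ρ : ℝ} (h0 : 3 * ρ < s0) {L : ℕ} (hL : s0 / 2 ^ L ≤ 3 * ρ) :
    ∃ n ≤ L, 3 * ρ < s0 / 2 ^ n ∧ s0 / 2 ^ n ≤ 6 * ρ := by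
  induction L with
  | zero => simp at hL; linarith
  | succ L ih =>
    rcases le_or_gt (s0 / 2 ^ L) (3 * ρ) with h | h
    · obtain ⟨n, hn, h'⟩ := ih h
      exact ⟨n, hn.trans L.le_succ, h'⟩
    · refine ⟨L, L.le_succ, h, ?_⟩
      have : s0 / 2 ^ L = 2 * (s0 / 2 ^ (L + 1)) := by rw [pow_succ]; field_simp
      linarith

/-- The kernel of the fractional integral, truncated to `2 ^ (-N) ≤ 3 |x - y| < 2 ^ N`. -/
def truncKernel (N : ℕ) (x y : Rd d) : ℝ≥0∞ :=
  {z : Rd d × Rd d | 2 ^ N / 2 ^ (2 * N) ≤ 3 * ‖z.1 - z.2‖ ∧ 3 * ‖z.1 - z.2‖ < 2 ^ N}.indicator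
    (fun z => (ENNReal.ofReal (‖z.1 - z.2‖ ^ ((d : ℝ) - 1)))⁻¹) (x, y)

lemma truncKernel_le (hd : d ≠ 0) (N : ℕ) (x y : Rd d) :
    truncKernel N x y ≤ ENNReal.ofReal (6 ^ ((d : ℝ) - 1)) * ∑ τ : Fin d → Bool,
      ∑ n ∈ Finset.range (2 * N + 1), (ENNReal.ofReal (2 ^ N / 2 ^ n) /
        (dyadicGrid (gridShift (2 ^ N) τ) (by positivity : (0 : ℝ) < 2 ^ N)).vol n) *
        ((dyadicGrid (gridShift (2 ^ N) τ) (by positivity : (0 : ℝ) < 2 ^ N)).cell n x).indicator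
          1 y := by
  rw [truncKernel, Set.indicator]
  split_ifs with h
  swap
  · exact zero_le
  simp only [Set.mem_ofPred_eq] at h ⊢
  set ρ := ‖x - y‖
  obtain ⟨n, hn, h1, h2⟩ := exists_scale h.2 h.1
  obtain ⟨τ, hτ⟩ := exists_gridIdx_eq (by positivity) n h1
  have hs : (0 : ℝ) < 2 ^ N / 2 ^ n := by positivity
  have hρ : 0 < ρ := by linarith
  have hd1 : 0 ≤ (d : ℝ) - 1 := by
    have : (1 : ℝ) ≤ d := by exact_mod_cast Nat.one_le_iff_ne_zero.2 hd
    linarith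
  have key : (ENNReal.ofReal (ρ ^ ((d : ℝ) - 1)))⁻¹ ≤ ENNReal.ofReal (6 ^ ((d : ℝ) - 1)) *
      (ENNReal.ofReal (2 ^ N / 2 ^ n) / ENNReal.ofReal ((2 ^ N / 2 ^ n) ^ d)) := by
    rw [← ENNReal.ofReal_div_of_pos (by positivity), ← ENNReal.ofReal_mul (by positivity),
      ← ENNReal.ofReal_inv_of_pos (by positivity)]
    refine ENNReal.ofReal_le_ofReal ?_
    set s : ℝ := 2 ^ N / 2 ^ n
    have h3 : s / s ^ d = (s ^ ((d : ℝ) - 1))⁻¹ := by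
      rw [Real.rpow_sub hs, Real.rpow_one, Real.rpow_natCast, inv_div]
    rw [h3, ← div_eq_mul_inv, inv_le_comm₀ (by positivity) (by positivity), inv_div,
      ← Real.div_rpow hs.le (by norm_num)]
    refine Real.rpow_le_rpow (by positivity) ?_ hd1
    linarith
  refine key.trans (mul_le_mul' le_rfl ?_)
  refine le_trans ?_ (Finset.single_le_sum (fun _ _ => zero_le) (Finset.mem_univ τ))
  refine le_trans ?_ (Finset.single_le_sum (fun _ _ => zero_le)
    (Finset.mem_range.2 (Nat.lt_succ_of_le hn)))
  rw [Set.indicator_of_mem (by exact hτ)]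
  simp [dyadicGrid]

/-- The constant in the bound for the truncated fractional integral. -/
def truncConst (d : ℕ) (Φ Ψ : ℝ → ℝ) (p q q' : ℝ) (K : ℝ≥0∞) : ℝ≥0∞ :=
  ENNReal.ofReal (6 ^ ((d : ℝ) - 1)) * (2 ^ d *
    (8 * ((2 + ENNReal.ofReal (assoc Φ 1)) * (2 + ENNReal.ofReal (assoc Ψ 1)) * K) *
      (bumpConst (assocE Φ) q (q / p) ^ (1 / q) * bumpConst (assocE Ψ) q' 1 ^ (1 / q'))))

theorem lintegral_mul_lintegral_truncKernel_le {Φ Ψ : ℝ → ℝ} (hΦ : IsYoungFunction Φ)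
    (hΨ : IsYoungFunction Ψ) (hd : d ≠ 0) {p q q' : ℝ} (hp : 1 < p) (hpq : p ≤ q)
    (hqq : q.HolderConjugate q') {w v : Rd d → ℝ} (hw : ∀ x, 0 ≤ w x) (hv : ∀ x, 0 ≤ v x)
    {f F h G : Rd d → ℝ≥0∞} (hf : Measurable f) (hh : Measurable h)
    (hFm : Measurable F) (hGm : Measurable G) (hGi : ∫⁻ x, G x ≠ ⊤)
    {M : ℝ≥0∞} (hM : M ≠ ⊤) (hfM : ∀ x, f x ≤ M) (hhM : ∀ x, h x ≤ M)
    {R : ℝ} (hfR : ∀ x, f x ≠ 0 → ∀ i, |x i| ≤ R) (hhR : ∀ x, h x ≠ 0 → ∀ i, |x i| ≤ R)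
    (hF : ∀ x, F x ≤ ENNReal.ofReal (w x) * f x) (hG : ∀ x, G x ≤ ENNReal.ofReal (v x) * h x)
    {K : ℝ≥0∞} (hK : K ≠ ⊤)
    (hbump : ∀ Q : Cube d, ENNReal.ofReal (Q.vol ^ (1 / (d : ℝ) + 1 / q - 1 / p)) *
      luxNorm Ψ Q v * luxNorm Φ Q w ≤ K) (N : ℕ) :
    ∫⁻ x, G x * ∫⁻ y, F y * truncKernel N x y ≤
      truncConst d Φ Ψ p q q' K * ((∫⁻ x, f x ^ p) ^ (1 / p) * (∫⁻ x, h x ^ q') ^ (1 / q')) := by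
  have hs : (0 : ℝ) < 2 ^ N := by positivity
  set 𝒢 : (Fin d → Bool) → UniformGrid (volume : Measure (Rd d)) (Fin d → ℤ) := fun τ =>
    dyadicGrid (gridShift (2 ^ N) τ) hs with h𝒢
  set l : ℕ → ℝ≥0∞ := fun n => ENNReal.ofReal (2 ^ N / 2 ^ n) with hl
  set c := ENNReal.ofReal (6 ^ ((d : ℝ) - 1)) with hc
  have hgrid (τ : Fin d → Bool) : ∑ n ∈ Finset.range (2 * N + 1),
      ∫⁻ x, l n * (G x * (𝒢 τ).avg n F x) ≤
      8 * ((2 + ENNReal.ofReal (assoc Φ 1)) * (2 + ENNReal.ofReal (assoc Ψ 1)) * K) *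
      (bumpConst (assocE Φ) q (q / p) ^ (1 / q) * bumpConst (assocE Ψ) q' 1 ^ (1 / q')) *
      ((∫⁻ x, f x ^ p) ^ (1 / p) * (∫⁻ x, h x ^ q') ^ (1 / q')) := by
    let D : Cube d := ⟨fun _ => -(|R| + 2 ^ N), 2 * (|R| + 2 ^ N) + 1, by positivity⟩
    have hDmem {g : Rd d → ℝ≥0∞} (hg : ∀ x, g x ≠ 0 → ∀ i, |x i| ≤ R) (x y : Rd d)
        (hxy : (𝒢 τ).idx 0 x = (𝒢 τ).idx 0 y) (hy : g y ≠ 0) : x ∈ D.set := by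
      intro i
      have h1 := abs_lt.1 (abs_sub_lt_of_gridIdx_eq hs hxy i)
      have h2 := abs_le.1 ((hg y hy i).trans (le_abs_self R))
      simp only [D]
      constructor <;> linarith [h1.1, h1.2, h2.1, h2.2]
    refine (𝒢 τ).sum_lintegral_mul_avg_le_of_lux (assocE_mono hΦ)
      (fun _ => assocE_of_le_one) (assocE_mono hΨ) (fun _ => assocE_of_le_one) hp hpq hqq
      hf hh hFm hGm hGi hM hfM hhM (measurableSet_cube D)
      (by rw [volume_cube]; exact ENNReal.ofReal_ne_top) (hDmem hfR) (hDmem hhR) l ?_ ?_ _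
    · intro n
      simp only [hl]
      rw [← ENNReal.ofReal_ofNat, ← ENNReal.ofReal_mul (by norm_num)]
      congr 1
      rw [pow_succ]; field_simp
    · intro n x
      exact mul_avg_mul_avg_le (𝒢 τ) hΦ hΨ hd (dyadicGrid_cell _ hs n x) rfl hw hv hf hh hM
        hfM hhM hF hG hK (hbump _)
  have havg (τ : Fin d → Bool) (n : ℕ) : Measurable ((𝒢 τ).avg n F) :=
    ((𝒢 τ).cellConst_avg n F).measurable
  have hin (x : Rd d) : ∫⁻ y, F y * truncKernel N x y ≤
      c * ∑ τ : Fin d → Bool, ∑ n ∈ Finset.range (2 * N + 1), l n * (𝒢 τ).avg n F x := by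
    have h1 (τ : Fin d → Bool) (n : ℕ) :
        Measurable fun y => F y * (l n / (𝒢 τ).vol n * ((𝒢 τ).cell n x).indicator 1 y) :=
      hFm.mul ((measurable_one.indicator ((𝒢 τ).measurableSet_cell n x)).const_mul _)
    have h2 (τ : Fin d → Bool) (n : ℕ) :
        ∫⁻ y, F y * (l n / (𝒢 τ).vol n * ((𝒢 τ).cell n x).indicator 1 y) =
          l n * (𝒢 τ).avg n F x := by
      have : (fun y => F y * (l n / (𝒢 τ).vol n * ((𝒢 τ).cell n x).indicator 1 y)) =
          fun y => l n / (𝒢 τ).vol n * ((𝒢 τ).cell n x).indicator F y := by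
        ext y
        by_cases hy : y ∈ (𝒢 τ).cell n x
        · simp [hy, mul_comm]
        · simp [hy]
      rw [this, lintegral_const_mul _ (hFm.indicator ((𝒢 τ).measurableSet_cell n x)),
        lintegral_indicator ((𝒢 τ).measurableSet_cell n x), UniformGrid.avg]
      simp only [div_eq_mul_inv]
      ring
    calc _ ≤ ∫⁻ y, c * ∑ τ : Fin d → Bool, ∑ n ∈ Finset.range (2 * N + 1),
          F y * (l n / (𝒢 τ).vol n * ((𝒢 τ).cell n x).indicator 1 y) := by
          refine lintegral_mono fun y => ?_
          refine (mul_le_mul' le_rfl (truncKernel_le hd N x y)).trans_eq ?_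
          rw [mul_left_comm, Finset.mul_sum]
          simp only [Finset.mul_sum]
          rfl
      _ = _ := by
          rw [lintegral_const_mul _ (Finset.measurable_fun_sum _ fun τ _ =>
            Finset.measurable_fun_sum _ fun n _ => h1 τ n),
            lintegral_finsetSum _ fun τ _ => Finset.measurable_fun_sum _ fun n _ => h1 τ n]
          congr 1
          refine Finset.sum_congr rfl fun τ _ => ?_
          rw [lintegral_finsetSum _ fun n _ => h1 τ n]
          exact Finset.sum_congr rfl fun n _ => h2 τ n
  have h3 (τ : Fin d → Bool) (n : ℕ) : Measurable fun x => l n * (G x * (𝒢 τ).avg n F x) :=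
    (hGm.mul (havg τ n)).const_mul _
  calc _ ≤ ∫⁻ x, c * ∑ τ : Fin d → Bool, ∑ n ∈ Finset.range (2 * N + 1),
        l n * (G x * (𝒢 τ).avg n F x) := by
        refine lintegral_mono fun x => (mul_le_mul' le_rfl (hin x)).trans_eq ?_
        rw [mul_left_comm, Finset.mul_sum]
        simp only [Finset.mul_sum, mul_left_comm]
    _ = c * ∑ τ : Fin d → Bool, ∑ n ∈ Finset.range (2 * N + 1),
        ∫⁻ x, l n * (G x * (𝒢 τ).avg n F x) := by
        rw [lintegral_const_mul _ (Finset.measurable_fun_sum _ fun τ _ =>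
          Finset.measurable_fun_sum _ fun n _ => h3 τ n),
          lintegral_finsetSum _ fun τ _ => Finset.measurable_fun_sum _ fun n _ => h3 τ n]
        congr 1
        exact Finset.sum_congr rfl fun τ _ => lintegral_finsetSum _ fun n _ => h3 τ n
    _ ≤ c * ((Finset.univ : Finset (Fin d → Bool)).card • _) :=
        mul_le_mul' le_rfl (Finset.sum_le_card_nsmul _ _ _ fun τ _ => hgrid τ)
    _ = _ := by
        rw [truncConst, Finset.card_univ]
        simp only [Fintype.card_pi, Fintype.card_bool, Finset.prod_const, Finset.card_univ,
          Fintype.card_fin, nsmul_eq_mul]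
        push_cast
        ring

end Grid

section Cutoff

variable {X : Type*}

/-- The function `min f m`, restricted to `E m`. -/
def cutoff (E : ℕ → Set X) (f : X → ℝ≥0∞) (m : ℕ) (x : X) : ℝ≥0∞ :=
  (E m).indicator (fun x => min (f x) m) x

variable {E : ℕ → Set X} {f : X → ℝ≥0∞}

lemma cutoff_le (m : ℕ) (x : X) : cutoff E f m x ≤ f x :=
  (Set.indicator_le_self _ _ x).trans (min_le_left _ _)

lemma cutoff_le_natCast (m : ℕ) (x : X) : cutoff E f m x ≤ m :=
  (Set.indicator_le_self _ _ x).trans (min_le_right _ _)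

lemma mem_of_cutoff_ne_zero {m : ℕ} {x : X} (h : cutoff E f m x ≠ 0) : x ∈ E m :=
  Set.mem_of_indicator_ne_zero h

lemma cutoff_mono (hE : Monotone E) (x : X) : Monotone fun m => cutoff E f m x := by
  intro m n h
  simp only [cutoff]
  by_cases hx : x ∈ E m
  · rw [Set.indicator_of_mem hx, Set.indicator_of_mem (hE h hx)]
    exact min_le_min_left _ (by exact_mod_cast h)
  · rw [Set.indicator_of_notMem hx]; exact zero_le

lemma iSup_cutoff (hE : Monotone E) (hU : ∀ x, ∃ m, x ∈ E m) (x : X) :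
    ⨆ m, cutoff E f m x = f x := by
  refine le_antisymm (iSup_le fun m => cutoff_le m x) (le_of_forall_lt fun c hc => ?_)
  obtain ⟨m, hm⟩ := hU x
  obtain ⟨n, hn⟩ := ENNReal.exists_nat_gt (hc.trans_le le_top).ne
  refine lt_of_lt_of_le ?_ (le_iSup (fun m => cutoff E f m x) (max m n))
  rw [cutoff, Set.indicator_of_mem (hE (le_max_left m n) hm)]
  exact lt_min hc (hn.trans_le (by exact_mod_cast le_max_right m n))

lemma measurable_cutoff [MeasurableSpace X] {m : ℕ} (hE : MeasurableSet (E m))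
    (hf : Measurable f) : Measurable (cutoff E f m) :=
  (hf.min measurable_const).indicator hE

end Cutoff

section Limit

variable {d : ℕ}

lemma measurable_truncKernel (N : ℕ) :
    Measurable fun z : Rd d × Rd d => truncKernel N z.1 z.2 := by
  have hm : Measurable fun z : Rd d × Rd d => 3 * ‖z.1 - z.2‖ := by fun_prop
  refine Measurable.indicator ?_ ?_
  · exact (ENNReal.measurable_ofReal.comp (by fun_prop)).inv
  · exact (measurableSet_le measurable_const hm).inter (measurableSet_lt hm measurable_const)

lemma measurable_truncKernel_right (N : ℕ) (x : Rd d) : Measurable (truncKernel N x) := by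
  have h : Measurable (Function.uncurry (truncKernel (d := d) N)) := measurable_truncKernel N
  exact h.of_uncurry_left

lemma truncKernel_mono (x y : Rd d) : Monotone fun N => truncKernel N x y := by
  refine monotone_nat_of_le_succ fun N => Set.indicator_le_indicator_of_subset ?_
    (fun _ => zero_le) _
  rintro z ⟨h1, h2⟩
  refine ⟨le_trans ?_ h1, h2.trans_le ?_⟩
  · rw [div_le_div_iff₀ (by positivity) (by positivity), ← pow_add, ← pow_add]
    exact pow_le_pow_right₀ (by norm_num) (by omega)
  · exact pow_le_pow_right₀ (by norm_num) (by omega)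

lemma iSup_truncKernel {x y : Rd d} (h : x ≠ y) :
    ⨆ N, truncKernel N x y = (ENNReal.ofReal (‖x - y‖ ^ ((d : ℝ) - 1)))⁻¹ := by
  refine le_antisymm (iSup_le fun N => Set.indicator_le_self _ _ _) ?_
  have hρ : 0 < 3 * ‖x - y‖ := by
    have := norm_pos_iff.2 (sub_ne_zero.2 h)
    positivity
  obtain ⟨n, hn⟩ := pow_unbounded_of_one_lt (3 * ‖x - y‖) (one_lt_two (α := ℝ))
  obtain ⟨k, hk⟩ := pow_unbounded_of_one_lt (3 * ‖x - y‖)⁻¹ (one_lt_two (α := ℝ))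
  refine le_trans ?_ (le_iSup _ (max n k))
  rw [truncKernel, Set.indicator_of_mem]
  have h1 : (2 : ℝ) ^ n ≤ 2 ^ max n k := pow_le_pow_right₀ (by norm_num) (le_max_left _ _)
  have h2 : (2 : ℝ) ^ k ≤ 2 ^ max n k := pow_le_pow_right₀ (by norm_num) (le_max_right _ _)
  refine ⟨?_, hn.trans_le h1⟩
  simp only
  rw [two_mul, pow_add, div_mul_cancel_left₀ (by positivity), inv_le_comm₀ (by positivity) hρ]
  exact hk.le.trans h2

/-- The points all of whose coordinates are at most `m` in absolute value. -/
def box (d m : ℕ) : Set (Rd d) := {x | ∀ i, |x i| ≤ m}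

lemma box_mono : Monotone (box d) := fun _ _ h _ hx i =>
  (hx i).trans (Nat.cast_le.2 h)

lemma exists_mem_box (x : Rd d) : ∃ m, x ∈ box d m := by
  obtain ⟨m, hm⟩ := exists_nat_ge ‖x‖
  exact ⟨m, fun i => (PiLp.norm_apply_le x i).trans hm⟩

lemma measurableSet_box (m : ℕ) : MeasurableSet (box d m) := by
  have : box d m = ⋂ i, {x : Rd d | |x i| ≤ m} := by ext; simp [box]
  rw [this]
  exact MeasurableSet.iInter fun i => measurableSet_le (by fun_prop) (by fun_prop)

lemma volume_box_ne_top (m : ℕ) : volume (box d m) ≠ ⊤ := by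
  let D : Cube d := ⟨fun _ => -(m : ℝ), 2 * m + 1, by positivity⟩
  have h : box d m ⊆ D.set := fun x hx i => by
    have := abs_le.1 (hx i)
    simp only [D]
    constructor <;> linarith [this.1, this.2]
  refine ((measure_mono h).trans_lt ?_).ne
  rw [volume_cube]
  exact ENNReal.ofReal_lt_top

/-- Testing a function against its own powers. -/
lemma lintegral_rpow_le_of_test {q q' : ℝ} (hqq : q.HolderConjugate q') {X v : Rd d → ℝ≥0∞}
    (hX : Measurable X) (hv : Measurable v) (hvt : ∀ x, v x ≠ ⊤) {C : ℝ≥0∞}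
    (hC : ∀ h : Rd d → ℝ≥0∞, Measurable h → ∀ M ≠ ⊤, (∀ x, h x ≤ M) →
      ∀ m : ℕ, (∀ x, h x ≠ 0 → x ∈ box d m) → ∫⁻ x, v x * h x ≠ ⊤ →
      ∫⁻ x, X x * h x ≤ C * (∫⁻ x, h x ^ q') ^ (1 / q')) :
    (∫⁻ x, X x ^ q) ^ (1 / q) ≤ C := by
  have hq0 : 0 < q := hqq.pos
  have hq1 : 0 < q - 1 := hqq.sub_one_pos
  have hq0' : 0 < q' := hqq.symm.pos
  set E : ℕ → Set (Rd d) := fun m => box d m ∩ {x | v x ≤ m} with hE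
  have hEm : Monotone E := fun m n h =>
    Set.inter_subset_inter (box_mono h) fun x hx => le_trans (Set.mem_ofPred.1 hx) (Nat.cast_le.2 h)
  have hEU (x : Rd d) : ∃ m, x ∈ E m := by
    obtain ⟨m, hm⟩ := exists_mem_box x
    obtain ⟨n, hn⟩ := ENNReal.exists_nat_gt (hvt x)
    exact ⟨max m n, box_mono (le_max_left m n) hm,
      hn.le.trans (by exact_mod_cast le_max_right m n)⟩
  have hEms (m : ℕ) : MeasurableSet (E m) :=
    (measurableSet_box m).inter (measurableSet_le hv measurable_const)
  have hEv (m : ℕ) : volume (E m) ≠ ⊤ :=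
    ((measure_mono Set.inter_subset_left).trans_lt (volume_box_ne_top m).lt_top).ne
  have hbound (m : ℕ) : (∫⁻ x, cutoff E X m x ^ q) ^ (1 / q) ≤ C := by
    set Y := cutoff E X m with hY
    have hYm : Measurable Y := measurable_cutoff (hEms m) hX
    have hYle : ∀ x, Y x ≤ m := cutoff_le_natCast m
    have hpow : (m : ℝ≥0∞) ^ (q - 1) ≠ ⊤ :=
      ENNReal.rpow_ne_top_of_nonneg hq1.le (ENNReal.natCast_ne_top m)
    have hind {e : ℝ} (he : 0 < e) {a b : Rd d → ℝ≥0∞} {c : ℝ≥0∞}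
        (hab : ∀ x ∈ E m, a x * Y x ^ e ≤ c) (hc : c ≠ ⊤) : ∫⁻ x, a x * Y x ^ e ≠ ⊤ := by
      have hle (x : Rd d) : a x * Y x ^ e ≤ (E m).indicator (fun _ => c) x := by
        by_cases hx : x ∈ E m
        · rw [Set.indicator_of_mem hx]; exact hab x hx
        · have : Y x = 0 := by simp [hY, cutoff, hx]
          simp [this, he]
      refine ((lintegral_mono hle).trans_lt ?_).ne
      rw [lintegral_indicator (hEms m), setLIntegral_const]
      exact ENNReal.mul_lt_top hc.lt_top (hEv m).lt_top
    have hI : ∫⁻ x, Y x ^ q ≠ ⊤ := by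
      have := hind hq0 (a := fun _ => 1) (b := Y) (c := (m : ℝ≥0∞) ^ q)
        (fun x _ => by rw [one_mul]; exact ENNReal.rpow_le_rpow (hYle x) hq0.le)
        (ENNReal.rpow_ne_top_of_nonneg hq0.le (ENNReal.natCast_ne_top m))
      simpa using this
    have hvh : ∫⁻ x, v x * Y x ^ (q - 1) ≠ ⊤ :=
      hind hq1 (b := Y) (c := m * (m : ℝ≥0∞) ^ (q - 1))
        (fun x hx => mul_le_mul' hx.2 (ENNReal.rpow_le_rpow (hYle x) hq1.le))
        (ENNReal.mul_ne_top (ENNReal.natCast_ne_top m) hpow)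
    have h1 := hC (fun x => Y x ^ (q - 1)) (hYm.pow_const _) _ hpow
      (fun x => ENNReal.rpow_le_rpow (hYle x) hq1.le) m
      (fun x hx => (mem_of_cutoff_ne_zero (E := E) (f := X) (m := m) (x := x)
        fun h0 => hx (by rw [← hY] at h0; simp [h0, hq1])).1) hvh
    have h2 : ∫⁻ x, Y x ^ q ≤ C * (∫⁻ x, Y x ^ q) ^ (1 / q') := by
      have h3 (x : Rd d) : (Y x ^ (q - 1)) ^ q' = Y x ^ q := by
        rw [← ENNReal.rpow_mul, hqq.sub_one_mul_conj]
      simp only [h3] at h1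
      refine le_trans (lintegral_mono fun x => ?_) h1
      calc Y x ^ q = Y x ^ (1 + (q - 1)) := by ring_nf
        _ = Y x * Y x ^ (q - 1) := by
          rw [ENNReal.rpow_add_of_nonneg _ _ zero_le_one hq1.le, ENNReal.rpow_one]
        _ ≤ X x * Y x ^ (q - 1) := mul_le_mul' (cutoff_le m x) le_rfl
    rcases eq_or_ne (∫⁻ x, Y x ^ q) 0 with h0 | h0
    · rw [h0, ENNReal.zero_rpow_of_pos (by positivity)]; exact zero_le
    have h4 : ∫⁻ x, Y x ^ q = (∫⁻ x, Y x ^ q) ^ (1 / q) * (∫⁻ x, Y x ^ q) ^ (1 / q') := by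
      rw [← ENNReal.rpow_add _ _ h0 hI, one_div, one_div, hqq.inv_add_inv_eq_one,
        ENNReal.rpow_one]
    nth_rewrite 1 [h4] at h2
    exact (ENNReal.mul_le_mul_iff_left
      (ENNReal.rpow_pos (pos_iff_ne_zero.2 h0) hI).ne'
      (ENNReal.rpow_ne_top_of_nonneg (by positivity) hI)).1 h2
  have hsup : ∫⁻ x, X x ^ q = ⨆ m, ∫⁻ x, cutoff E X m x ^ q := by
    rw [← lintegral_iSup (fun m => (measurable_cutoff (hEms m) hX).pow_const q)
      fun m n h x => ENNReal.rpow_le_rpow (cutoff_mono hEm x h) hq0.le]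
    congr 1
    ext x
    rw [← iSup_cutoff (f := X) hEm hEU x]
    exact (ENNReal.orderIsoRpow q hq0).map_iSup _
  have hC' : ∫⁻ x, X x ^ q ≤ C ^ q := by
    rw [hsup]
    refine iSup_le fun m => ?_
    have := ENNReal.rpow_le_rpow (hbound m) hq0.le
    rwa [← ENNReal.rpow_mul, one_div_mul_cancel hq0.ne', ENNReal.rpow_one] at this
  have := ENNReal.rpow_le_rpow hC' (by positivity : 0 ≤ 1 / q)
  rwa [← ENNReal.rpow_mul, mul_one_div_cancel hq0.ne', ENNReal.rpow_one] at this

lemma iSup_mul_iSup_of_monotone {a b : ℕ → ℝ≥0∞} (ha : Monotone a) (hb : Monotone b) :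
    (⨆ N, a N) * ⨆ N, b N = ⨆ N, a N * b N := by
  refine le_antisymm ?_ (iSup_le fun N => mul_le_mul' (le_iSup a N) (le_iSup b N))
  rw [ENNReal.iSup_mul]
  refine iSup_le fun m => ?_
  rw [ENNReal.mul_iSup]
  exact iSup_le fun n => le_iSup_of_le (max m n)
    (mul_le_mul' (ha (le_max_left m n)) (hb (le_max_right m n)))

/-- The truncated fractional integral of `w f`. -/
def truncFractional (w f : Rd d → ℝ≥0∞) (N : ℕ) (x : Rd d) : ℝ≥0∞ :=
  ∫⁻ y, w y * cutoff (box d) f N y * truncKernel N x y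

lemma measurable_truncFractional {w f : Rd d → ℝ≥0∞} (hw : Measurable w) (hf : Measurable f)
    (N : ℕ) : Measurable (truncFractional w f N) := by
  have h1 : Measurable fun y => w y * cutoff (box d) f N y :=
    hw.mul (measurable_cutoff (measurableSet_box N) hf)
  have h2 : Measurable fun z : Rd d × Rd d => w z.2 * cutoff (box d) f N z.2 :=
    h1.comp measurable_snd
  have h3 : Measurable fun z : Rd d × Rd d =>
      w z.2 * cutoff (box d) f N z.2 * truncKernel N z.1 z.2 :=
    h2.mul (measurable_truncKernel N)
  exact h3.lintegral_prod_right'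

lemma monotone_mul_cutoff_mul_truncKernel (w f : Rd d → ℝ≥0∞) (x y : Rd d) :
    Monotone fun N => w y * cutoff (box d) f N y * truncKernel N x y := fun _ _ h =>
  mul_le_mul' (mul_le_mul' le_rfl (cutoff_mono box_mono y h)) (truncKernel_mono x y h)

lemma truncFractional_mono (w f : Rd d → ℝ≥0∞) (x : Rd d) :
    Monotone fun N => truncFractional w f N x := fun _ _ h =>
  lintegral_mono fun y => monotone_mul_cutoff_mul_truncKernel w f x y h

lemma iSup_truncFractional [NeZero d] {w f : Rd d → ℝ≥0∞} (hw : Measurable w)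
    (hf : Measurable f) (x : Rd d) :
    ⨆ N, truncFractional w f N x =
      ∫⁻ y, w y * f y * (ENNReal.ofReal (‖x - y‖ ^ ((d : ℝ) - 1)))⁻¹ := by
  have hkm (N : ℕ) : Measurable fun y => truncKernel N x y :=
    measurable_truncKernel_right N x
  have h1 : ⨆ N, truncFractional w f N x =
      ∫⁻ y, ⨆ N, w y * cutoff (box d) f N y * truncKernel N x y :=
    (lintegral_iSup
      (fun N => (hw.mul (measurable_cutoff (measurableSet_box N) hf)).mul (hkm N))
      fun m n h y => monotone_mul_cutoff_mul_truncKernel w f x y h).symm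
  have hae : ∀ᵐ y : Rd d, y ≠ x := by
    rw [ae_iff]; simp
  rw [h1]
  refine lintegral_congr_ae (hae.mono fun y hy => ?_)
  simp only
  have h2 : w y * f y = ⨆ N, w y * cutoff (box d) f N y := by
    rw [← ENNReal.mul_iSup, iSup_cutoff box_mono exists_mem_box y]
  rw [← iSup_truncKernel hy.symm, h2]
  exact (iSup_mul_iSup_of_monotone
    (fun m n h => mul_le_mul' le_rfl (cutoff_mono box_mono y h)) (truncKernel_mono x y)).symm

lemma lintegral_truncFractional_le {Φ Ψ : ℝ → ℝ} (hΦ : IsYoungFunction Φ)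
    (hΨ : IsYoungFunction Ψ) (hd : d ≠ 0) {p q q' : ℝ} (hp : 1 < p) (hpq : p ≤ q)
    (hqq : q.HolderConjugate q') {w v : Rd d → ℝ} (hw : ∀ x, 0 ≤ w x) (hv : ∀ x, 0 ≤ v x)
    (hwm : Measurable w) (hvm : Measurable v) {f : Rd d → ℝ≥0∞} (hf : Measurable f)
    {K : ℝ≥0∞} (hK : K ≠ ⊤)
    (hbump : ∀ Q : Cube d, ENNReal.ofReal (Q.vol ^ (1 / (d : ℝ) + 1 / q - 1 / p)) *
      luxNorm Ψ Q v * luxNorm Φ Q w ≤ K) (N : ℕ) :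
    (∫⁻ x, (ENNReal.ofReal (v x) *
      truncFractional (fun y => ENNReal.ofReal (w y)) f N x) ^ q) ^ (1 / q) ≤
      truncConst d Φ Ψ p q q' K * (∫⁻ x, f x ^ p) ^ (1 / p) := by
  have hp0 : 0 < p := by linarith
  have hq0 : 0 < q' := hqq.symm.pos
  have hfm : Measurable (cutoff (box d) f N) := measurable_cutoff (measurableSet_box N) hf
  refine lintegral_rpow_le_of_test hqq (X := fun x => ENNReal.ofReal (v x) *
      truncFractional (fun y => ENNReal.ofReal (w y)) f N x)
    (hvm.ennreal_ofReal.mul (measurable_truncFractional hwm.ennreal_ofReal hf N))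
    hvm.ennreal_ofReal
    (fun x => ENNReal.ofReal_ne_top) fun h hh M hM hhM m hm hvh => ?_
  have h1 := lintegral_mul_lintegral_truncKernel_le hΦ hΨ hd hp hpq hqq hw hv hfm hh
    (hwm.ennreal_ofReal.mul hfm) (hvm.ennreal_ofReal.mul hh) hvh (M := max M N)
    (max_lt hM.lt_top (ENNReal.natCast_lt_top N)).ne
    (fun x => (cutoff_le_natCast N x).trans (le_max_right _ _))
    (fun x => (hhM x).trans (le_max_left _ _)) (R := max m N)
    (fun x hx i => (mem_of_cutoff_ne_zero hx i).trans (le_max_right _ _))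
    (fun x hx i => (hm x hx i).trans (le_max_left _ _))
    (fun x => le_rfl) (fun x => le_rfl) hK hbump N
  have h2 : ∫⁻ x, cutoff (box d) f N x ^ p ≤ ∫⁻ x, f x ^ p :=
    lintegral_mono fun x => ENNReal.rpow_le_rpow (cutoff_le N x) hp0.le
  have h3 := ENNReal.rpow_le_rpow h2 (by positivity : 0 ≤ 1 / p)
  have h4 : ∫⁻ x, ENNReal.ofReal (v x) *
      truncFractional (fun y => ENNReal.ofReal (w y)) f N x * h x =
      ∫⁻ x, ENNReal.ofReal (v x) * h x *
        truncFractional (fun y => ENNReal.ofReal (w y)) f N x :=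
    lintegral_congr fun x => mul_right_comm _ _ _
  rw [h4, mul_assoc]
  exact h1.trans (mul_le_mul' le_rfl (mul_le_mul' h3 le_rfl))

theorem lintegral_fractional_le {Φ Ψ : ℝ → ℝ} (hΦ : IsYoungFunction Φ)
    (hΨ : IsYoungFunction Ψ) (hd : d ≠ 0) {p q q' : ℝ} (hp : 1 < p) (hpq : p ≤ q)
    (hqq : q.HolderConjugate q') {w v : Rd d → ℝ} (hw : ∀ x, 0 ≤ w x) (hv : ∀ x, 0 ≤ v x)
    (hwm : Measurable w) (hvm : Measurable v) {f : Rd d → ℝ≥0∞} (hf : Measurable f)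
    {K : ℝ≥0∞} (hK : K ≠ ⊤)
    (hbump : ∀ Q : Cube d, ENNReal.ofReal (Q.vol ^ (1 / (d : ℝ) + 1 / q - 1 / p)) *
      luxNorm Ψ Q v * luxNorm Φ Q w ≤ K) :
    (∫⁻ x, (ENNReal.ofReal (v x) * ∫⁻ y, ENNReal.ofReal (w y) * f y *
      (ENNReal.ofReal (‖x - y‖ ^ ((d : ℝ) - 1)))⁻¹) ^ q) ^ (1 / q) ≤
      truncConst d Φ Ψ p q q' K * (∫⁻ x, f x ^ p) ^ (1 / p) := by
  have hp0 : 0 < p := by linarith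
  have hq0 : 0 < q := hqq.pos
  have : NeZero d := ⟨hd⟩
  set W : Rd d → ℝ≥0∞ := fun y => ENNReal.ofReal (w y) with hW
  have hWm : Measurable W := hwm.ennreal_ofReal
  have hsup : ∫⁻ x, (ENNReal.ofReal (v x) * ∫⁻ y, W y * f y *
      (ENNReal.ofReal (‖x - y‖ ^ ((d : ℝ) - 1)))⁻¹) ^ q =
      ⨆ N, ∫⁻ x, (ENNReal.ofReal (v x) * truncFractional W f N x) ^ q := by
    rw [← lintegral_iSup
      (f := fun N x => (ENNReal.ofReal (v x) * truncFractional W f N x) ^ q)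
      (fun N => (hvm.ennreal_ofReal.mul (measurable_truncFractional hWm hf N)).pow_const q)
      fun m n h x =>
        ENNReal.rpow_le_rpow (mul_le_mul' le_rfl (truncFractional_mono W f x h)) hq0.le]
    congr 1
    ext x
    rw [← iSup_truncFractional hWm hf, ENNReal.mul_iSup]
    exact (ENNReal.orderIsoRpow q hq0).map_iSup _
  have hC' : ∫⁻ x, (ENNReal.ofReal (v x) * ∫⁻ y, W y * f y *
      (ENNReal.ofReal (‖x - y‖ ^ ((d : ℝ) - 1)))⁻¹) ^ q ≤
      (truncConst d Φ Ψ p q q' K * (∫⁻ x, f x ^ p) ^ (1 / p)) ^ q := by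
    rw [hsup]
    refine iSup_le fun m => ?_
    have := ENNReal.rpow_le_rpow
      (lintegral_truncFractional_le hΦ hΨ hd hp hpq hqq hw hv hwm hvm hf hK hbump m) hq0.le
    rwa [← ENNReal.rpow_mul, one_div_mul_cancel hq0.ne', ENNReal.rpow_one] at this
  have := ENNReal.rpow_le_rpow hC' (by positivity : 0 ≤ 1 / q)
  rwa [← ENNReal.rpow_mul, mul_one_div_cancel hq0.ne', ENNReal.rpow_one] at this

end Limit

section MatrixWeight

variable {n : ℕ}

lemma norm_mulVecE_le (A : Mat n) (v : Cn n) : ‖mulVecE A v‖ ≤ opNorm A * ‖v‖ :=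
  (Matrix.toEuclideanCLM (𝕜 := ℂ) A).le_opNorm v

lemma opNorm_nonneg (A : Mat n) : 0 ≤ opNorm A := norm_nonneg _

lemma continuous_opNorm : Continuous (opNorm : Mat n → ℝ) :=
  continuous_norm.comp
    (LinearMap.continuous_of_finiteDimensional
      (Matrix.toEuclideanCLM (𝕜 := ℂ) (n := Fin n)).toAlgEquiv.toLinearMap)

section Norm

open scoped Matrix.Norms.L2Operator

lemma opNorm_conj_diagonal (U : Matrix.unitaryGroup (Fin n) ℂ) (x : Fin n → ℂ) :
    opNorm ((U : Mat n) * Matrix.diagonal x * (star U : Mat n)) = ‖x‖ := by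
  have h (A : Mat n) : opNorm A = ‖A‖ := (Matrix.cstar_norm_def A).symm
  rw [h, ← Matrix.l2_opNorm_diagonal x]
  exact (CStarRing.norm_mul_coe_unitary _ (star U)).trans (CStarRing.norm_coe_unitary_mul U _)

end Norm

lemma matPow_neg_one {A : Mat n} (hA : A.PosDef) : matPow A (-1) = A⁻¹ := by
  symm
  refine Matrix.inv_eq_right_inv ?_
  have hs := hA.isHermitian.spectral_theorem
  set U := hA.isHermitian.eigenvectorUnitary
  have hU : (star U : Mat n) * (U : Mat n) = 1 := Unitary.coe_star_mul_self U
  have hU' : (U : Mat n) * (star U : Mat n) = 1 := Unitary.coe_mul_star_self U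
  rw [Unitary.conjStarAlgAut_apply] at hs
  rw [matPow, dif_pos hA.isHermitian]
  nth_rewrite 1 [hs]
  calc _ = (U : Mat n) * (Matrix.diagonal (RCLike.ofReal ∘ hA.isHermitian.eigenvalues) *
        (((star U : Mat n) * (U : Mat n)) *
        Matrix.diagonal (fun i => ((hA.isHermitian.eigenvalues i ^ (-1 : ℝ) : ℝ) : ℂ)))) *
        (star U : Mat n) := by simp only [U, Matrix.mul_assoc]
    _ = 1 := by
      rw [hU, Matrix.one_mul, Matrix.diagonal_mul_diagonal]
      have : (fun i => (RCLike.ofReal ∘ hA.isHermitian.eigenvalues) i *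
          ((hA.isHermitian.eigenvalues i ^ (-1 : ℝ) : ℝ) : ℂ)) = fun _ => (1 : ℂ) := by
        funext i
        have h0 : (hA.isHermitian.eigenvalues i : ℂ) ≠ 0 :=
          Complex.ofReal_ne_zero.2 (hA.eigenvalues_pos i).ne'
        simp [Real.rpow_neg_one, h0]
      rw [this, Matrix.diagonal_one, Matrix.mul_one, hU']

lemma opNorm_matPow {A : Mat n} (hA : A.PosDef) (r : ℝ) :
    opNorm (matPow A r) = ‖fun i => hA.isHermitian.eigenvalues i ^ r‖ := by
  rw [matPow, dif_pos hA.isHermitian, opNorm_conj_diagonal]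
  simp [Pi.norm_def, Complex.nnnorm_real]

lemma pi_norm_rpow {ι : Type*} [Fintype ι] {x : ι → ℝ} (hx : ∀ i, 0 ≤ x i) {s : ℝ} (hs : 0 < s) :
    ‖fun i => x i ^ s‖ = ‖x‖ ^ s := by
  refine le_antisymm ((pi_norm_le_iff_of_nonneg (by positivity)).2 fun i => ?_) ?_
  · rw [Real.norm_of_nonneg (Real.rpow_nonneg (hx i) s)]
    exact Real.rpow_le_rpow (hx i) ((le_abs_self _).trans (norm_le_pi_norm x i)) hs.le
  · have h : ‖x‖ ≤ ‖fun i => x i ^ s‖ ^ s⁻¹ := by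
      refine (pi_norm_le_iff_of_nonneg (by positivity)).2 fun i => ?_
      have h1 := Real.rpow_le_rpow (Real.rpow_nonneg (hx i) s)
        ((le_abs_self _).trans (norm_le_pi_norm (fun i => x i ^ s) i)) (inv_nonneg.2 hs.le)
      rwa [Real.rpow_rpow_inv (hx i) hs.ne', ← Real.norm_of_nonneg (hx i)] at h1
    have h2 := Real.rpow_le_rpow (norm_nonneg _) h hs.le
    rwa [Real.rpow_inv_rpow (norm_nonneg _) hs.ne'] at h2

lemma opNorm_matPow_neg {A : Mat n} (hA : A.PosDef) {s : ℝ} (hs : 0 < s) :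
    opNorm (matPow A (-s)) = opNorm A⁻¹ ^ s := by
  rw [← matPow_neg_one hA, opNorm_matPow hA, opNorm_matPow hA, ← pi_norm_rpow
    (fun i => Real.rpow_nonneg (hA.eigenvalues_pos i).le _) hs]
  congr 1
  funext i
  rw [← Real.rpow_mul (hA.eigenvalues_pos i).le, neg_one_mul]

lemma aemeasurable_opNorm_matPow_neg {d : ℕ} {V : Rd d → Mat n} (hV : IsMatrixWeight V)
    {s : ℝ} (hs : 0 < s) : AEMeasurable fun x => opNorm (matPow (V x) (-s)) := by
  have hm (i j : Fin n) : AEMeasurable fun x => V x i j :=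
    (hV.1 i j).aestronglyMeasurable.aemeasurable
  have hdet : AEMeasurable fun x => (V x).det := by
    simp only [Matrix.det_apply]
    fun_prop
  have hinv : AEMeasurable fun x => opNorm (V x)⁻¹ := by
    have hadj (i j : Fin n) : AEMeasurable fun x => (V x).adjugate i j := by
      simp only [Matrix.adjugate_apply, Matrix.det_apply]
      refine Finset.aemeasurable_fun_sum _ fun σ _ => AEMeasurable.const_smul
        (Finset.aemeasurable_fun_prod _ fun k _ => ?_) _
      simp only [Matrix.updateRow_apply]
      split_ifs
      · exact aemeasurable_const
      · exact hm _ _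
    have h1 : AEMeasurable fun x i j => (V x).det⁻¹ * (V x).adjugate i j :=
      aemeasurable_pi_lambda _ fun i => aemeasurable_pi_lambda _ fun j => hdet.inv.mul (hadj i j)
    have hc : Continuous fun M : Fin n → Fin n → ℂ => opNorm (Matrix.of M) := continuous_opNorm
    have h2 := hc.measurable
    refine (h2.comp_aemeasurable h1).congr (.of_forall fun x => ?_)
    simp only [Function.comp_apply]
    congr 1
    ext i j
    simp [Matrix.inv_def]
  refine (hinv.pow_const s).congr (hV.2.mono fun x hx => (opNorm_matPow_neg hx hs).symm)

end MatrixWeight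

section Assembly

variable {d : ℕ}

lemma luxNorm_congr_ae {Φ : ℝ → ℝ} {w w' : Rd d → ℝ} (h : w =ᵐ[volume] w') (Q : Cube d) :
    luxNorm Φ Q w = luxNorm Φ Q w' := by
  have (lam : ℝ≥0∞) :
      ∫⁻ x in Q.set, ENNReal.ofReal (Φ ((ENNReal.ofReal |w x|).toReal / lam.toReal)) =
      ∫⁻ x in Q.set, ENNReal.ofReal (Φ ((ENNReal.ofReal |w' x|).toReal / lam.toReal)) :=
    lintegral_congr_ae ((ae_restrict_of_ae h).mono fun x hx => by simp only [hx])
  simp only [luxNorm, luxNormE, this]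

/-- A nonnegative almost everywhere measurable function has a nonnegative measurable version. -/
lemma exists_measurable_nonneg_ae_eq {w : Rd d → ℝ} (hw : ∀ x, 0 ≤ w x) (hm : AEMeasurable w) :
    ∃ w' : Rd d → ℝ, Measurable w' ∧ (∀ x, 0 ≤ w' x) ∧ w =ᵐ[volume] w' :=
  ⟨fun x => max (hm.mk w x) 0, hm.measurable_mk.max measurable_const, fun _ => le_max_right _ _,
    hm.ae_eq_mk.mono fun x hx => by simp only [← hx, max_eq_left (hw x)]⟩

/-- A function dominated by a product has a measurable minorant of the same form with the same
integral against every measurable kernel. -/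
lemma exists_measurable_factor {W : Rd d → ℝ≥0∞} (hW : Measurable W) (hWt : ∀ x, W x ≠ ⊤)
    {F G : Rd d → ℝ≥0∞}
    (hFG : ∀ᵐ x, F x ≤ W x * G x) :
    ∃ f : Rd d → ℝ≥0∞, Measurable f ∧ f ≤ᵐ[volume] G ∧ ∀ κ : Rd d → ℝ≥0∞, Measurable κ →
      (∀ᵐ x, κ x ≠ 0) → (∀ᵐ x, κ x ≠ ⊤) → ∫⁻ x, F x * κ x ≤ ∫⁻ x, W x * f x * κ x := by
  obtain ⟨h, hm, hle, heq⟩ := exists_measurable_le_forall_setLIntegral_eq (μ := volume) F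
  refine ⟨fun x => h x / W x, hm.div hW, hFG.mono fun x hx => ?_, fun κ hκ hκ0 hκt => ?_⟩
  · exact ENNReal.div_le_of_le_mul ((hle x).trans (hx.trans_eq (mul_comm _ _)))
  have h1 : ∫⁻ x, F x * κ x ≤ ∫⁻ x, h x * κ x := by
    obtain ⟨k, hkm, hkle, hkeq⟩ := exists_measurable_le_lintegral_eq volume fun x => F x * κ x
    rw [hkeq]
    have h2 : (fun x => k x / κ x) ≤ᵐ[volume] h := by
      refine ae_le_of_forall_setLIntegral_le_of_sigmaFinite (hkm.div hκ) fun s hs hsv => ?_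
      rw [← heq]
      refine lintegral_mono fun x => ?_
      exact ENNReal.div_le_of_le_mul (hkle x)
    refine lintegral_mono_ae ?_
    filter_upwards [h2, hκ0, hκt] with x hx h0 ht
    calc k x = k x / κ x * κ x := (ENNReal.div_mul_cancel h0 ht).symm
      _ ≤ h x * κ x := mul_le_mul' hx le_rfl
  refine h1.trans (lintegral_mono_ae (hFG.mono fun x hx => mul_le_mul' ?_ le_rfl))
  rcases eq_or_ne (W x) 0 with h0 | h0
  · have : h x ≤ 0 := (hle x).trans (by simpa [h0] using hx)
    simp [le_antisymm this zero_le]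
  · exact (ENNReal.mul_div_cancel h0 (hWt x)).ge

lemma truncConst_ne_top {Φ Ψ : ℝ → ℝ} (hΦ : IsYoungFunction Φ) (hΨ : IsYoungFunction Ψ)
    {p q q' : ℝ} (hp : 0 < p) (hq : 0 < q) (hq' : 0 < q') (hΦB : MemBpq (assoc Φ) p q)
    (hΨB : MemBp (assoc Ψ) q') {K : ℝ≥0∞} (hK : K ≠ ⊤) : truncConst d Φ Ψ p q q' K ≠ ⊤ := by
  have h1 := ENNReal.rpow_ne_top_of_nonneg (one_div_pos.2 hq).le
    (bumpConst_ne_top_of_memBpq hΦ hp hq hΦB)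
  have h2 := ENNReal.rpow_ne_top_of_nonneg (one_div_pos.2 hq').le
    (bumpConst_ne_top_of_memBp hΨ hq' hΨB)
  unfold truncConst
  finiteness

lemma measurable_inv_norm_sub_rpow (x : Rd d) :
    Measurable fun y => (ENNReal.ofReal (‖x - y‖ ^ ((d : ℝ) - 1)))⁻¹ :=
  (ENNReal.measurable_ofReal.comp (by fun_prop)).inv

lemma ae_inv_norm_sub_rpow_ne_top (hd : d ≠ 0) (x : Rd d) :
    ∀ᵐ y, (ENNReal.ofReal (‖x - y‖ ^ ((d : ℝ) - 1)))⁻¹ ≠ ⊤ := by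
  have : NeZero d := ⟨hd⟩
  have hae : ∀ᵐ y : Rd d, y ≠ x := by
    rw [ae_iff]; simp
  refine hae.mono fun y hy => ?_
  have : 0 < ‖x - y‖ := norm_pos_iff.2 (sub_ne_zero.2 hy.symm)
  simp only [ne_eq, ENNReal.inv_eq_top, ENNReal.ofReal_eq_zero, not_le]
  positivity

end Assembly

end MixedBump

/-- **The key inequality (6.1) in the proof of Theorem 1.22.**  Under the mixed bump condition,
`‖u^{1/q} I_1(|V^{-1/p} g|)‖_{L^q} ≲ ‖g‖_{L^p}`, where
`I_1 h(x) = ∫ h(y)/|x-y|^{d-1} dy`. -/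
theorem mixed_fractional_integral_bound {d : ℕ} (p q : ℝ) (hp : 1 < p) (hpq : p ≤ q)
    (hexp : 1 / p - 1 / q ≤ 1 / (d : ℝ))
    (Φ Ψ : ℝ → ℝ) (hΦ : IsYoungFunction Φ) (hΨ : IsYoungFunction Ψ)
    (hΦB : MemBpq (assoc Φ) p q) (hΨB : MemBp (assoc Ψ) (q / (q - 1)))
    (u : Rd d → ℝ) (hu : IsScalarWeight u)
    (V : Rd d → Mat d) (hV : IsMatrixWeight V)
    (hbump : (⨆ Q : Cube d,
        ENNReal.ofReal (Q.vol ^ (1 / (d : ℝ) + 1 / q - 1 / p)) *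
          luxNorm Ψ Q (fun x => u x ^ (1 / q)) *
          luxNorm Φ Q (fun x => opNorm (matPow (V x) (-(1 / p))))) < ⊤) :
    ∃ C : ℝ, 0 < C ∧ ∀ g : Rd d → Cn d,
      (∫⁻ x, (ENNReal.ofReal (u x ^ (1 / q)) *
          ∫⁻ y, ENNReal.ofReal ‖mulVecE (matPow (V y) (-(1 / p))) (g y)‖ /
            ENNReal.ofReal (‖x - y‖ ^ ((d : ℝ) - 1))) ^ q) ^ (1 / q) ≤
        ENNReal.ofReal C * lpNorm p g := by
  have hp0 : 0 < p := by linarith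
  have hq0 : 0 < q := by linarith
  rcases eq_or_ne d 0 with rfl | hd
  · refine ⟨1, one_pos, fun g => ?_⟩
    have (y : Rd 0) : mulVecE (matPow (V y) (-(1 / p))) (g y) = 0 := Subsingleton.elim _ _
    simp only [this, norm_zero, ENNReal.ofReal_zero, ENNReal.zero_div, lintegral_zero, mul_zero,
      ENNReal.zero_rpow_of_pos hq0, ENNReal.zero_rpow_of_pos (one_div_pos.2 hq0)]
    exact zero_le
  have hqq : q.HolderConjugate (q / (q - 1)) := Real.HolderConjugate.conjExponent (by linarith)
  obtain ⟨w, hwm, hw0, hw⟩ := MixedBump.exists_measurable_nonneg_ae_eq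
    (fun x => MixedBump.opNorm_nonneg (matPow (V x) (-(1 / p))))
    (MixedBump.aemeasurable_opNorm_matPow_neg hV (one_div_pos.2 hp0))
  obtain ⟨v, hvm, hv0, hv⟩ := MixedBump.exists_measurable_nonneg_ae_eq
    (fun x => Real.rpow_nonneg (hu.1 x) (1 / q))
    (hu.2.aestronglyMeasurable.aemeasurable.pow_const (1 / q))
  set K := ⨆ Q : Cube d, ENNReal.ofReal (Q.vol ^ (1 / (d : ℝ) + 1 / q - 1 / p)) *
    luxNorm Ψ Q (fun x => u x ^ (1 / q)) *
    luxNorm Φ Q (fun x => opNorm (matPow (V x) (-(1 / p)))) with hK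
  have hKv (Q : Cube d) : ENNReal.ofReal (Q.vol ^ (1 / (d : ℝ) + 1 / q - 1 / p)) *
      luxNorm Ψ Q v * luxNorm Φ Q w ≤ K := by
    rw [← MixedBump.luxNorm_congr_ae hv, ← MixedBump.luxNorm_congr_ae hw, hK]
    exact le_iSup (fun Q : Cube d => ENNReal.ofReal (Q.vol ^ (1 / (d : ℝ) + 1 / q - 1 / p)) *
      luxNorm Ψ Q (fun x => u x ^ (1 / q)) *
      luxNorm Φ Q (fun x => opNorm (matPow (V x) (-(1 / p))))) Q
  have hT : MixedBump.truncConst d Φ Ψ p q (q / (q - 1)) K ≠ ⊤ :=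
    MixedBump.truncConst_ne_top hΦ hΨ hp0 hq0 hqq.symm.pos hΦB hΨB hbump.ne
  refine ⟨(MixedBump.truncConst d Φ Ψ p q (q / (q - 1)) K).toReal + 1, by positivity, fun g => ?_⟩
  obtain ⟨f, hfm, hfg, hf⟩ := MixedBump.exists_measurable_factor hwm.ennreal_ofReal
    (fun x => ENNReal.ofReal_ne_top)
    (F := fun y => ENNReal.ofReal ‖mulVecE (matPow (V y) (-(1 / p))) (g y)‖)
    (G := fun y => (‖g y‖₊ : ℝ≥0∞)) (hw.mono fun y hy => by
      rw [← hy, ← enorm_eq_nnnorm, ← ofReal_norm,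
        ← ENNReal.ofReal_mul (MixedBump.opNorm_nonneg _)]
      exact ENNReal.ofReal_le_ofReal (MixedBump.norm_mulVecE_le _ _))
  have hinner (x : Rd d) : ∫⁻ y, ENNReal.ofReal ‖mulVecE (matPow (V y) (-(1 / p))) (g y)‖ /
      ENNReal.ofReal (‖x - y‖ ^ ((d : ℝ) - 1)) ≤ ∫⁻ y, ENNReal.ofReal (w y) * f y *
        (ENNReal.ofReal (‖x - y‖ ^ ((d : ℝ) - 1)))⁻¹ :=
    hf _ (MixedBump.measurable_inv_norm_sub_rpow x)
      (.of_forall fun y => ENNReal.inv_ne_zero.2 ENNReal.ofReal_ne_top)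
      (MixedBump.ae_inv_norm_sub_rpow_ne_top hd x)
  calc _ ≤ (∫⁻ x, (ENNReal.ofReal (v x) * ∫⁻ y, ENNReal.ofReal (w y) * f y *
        (ENNReal.ofReal (‖x - y‖ ^ ((d : ℝ) - 1)))⁻¹) ^ q) ^ (1 / q) := by
        refine ENNReal.rpow_le_rpow (lintegral_mono_ae (hv.mono fun x hx => ?_)) (by positivity)
        simp only at hx
        rw [hx]
        exact ENNReal.rpow_le_rpow (mul_le_mul' le_rfl (hinner x)) hq0.le
    _ ≤ MixedBump.truncConst d Φ Ψ p q (q / (q - 1)) K * (∫⁻ x, f x ^ p) ^ (1 / p) :=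
        MixedBump.lintegral_fractional_le hΦ hΨ hd hp hpq hqq hw0 hv0 hwm hvm hfm hbump.ne hKv
    _ ≤ _ := by
        refine mul_le_mul' ?_ (ENNReal.rpow_le_rpow (lintegral_mono_ae (hfg.mono fun x hx =>
          ENNReal.rpow_le_rpow hx hp0.le)) (by positivity))
        rw [← ENNReal.ofReal_toReal hT]
        exact ENNReal.ofReal_le_ofReal (by simp)

end
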